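/- arXiv:1611.02384 — 2 statements merged into one kernel-verified Lean document; each statement's English description precedes it below -/
import Mathlib

section
/- Suppose n ≥ 2. Let v = v(η²,...,η^{2n},τ) and u = u(η²,...,η^{2n},τ) be C^∞ functions defined on an open neighborhood U ⊆ ℝ^{2n} of a point p₀ = (η₀²,...,η₀^{2n},τ₀). For a function w on U, define the vector fields ê_j := ∂_{η^j} + η^{n+j}∂_τ for 2 ≤ j ≤ n, ê_{n+1}^w := ∂_{η^{n+1}} − 2w ∂_τ, and ê_{n+j} := ∂_{η^{n+j}} − η^j ∂_τ for 2 ≤ j ≤ n, and set W^w := (ê₂,...,ê_n, ê_{n+1}^w, ê_{n+2},...,ê_{2n}) with mean curvature operator W^w·(W^w(w)/√(1+|W^w(w)|²)) := Σ component-wise application of the fields of W^w to the corresponding components of W^w(w)/√(1+|W^w(w)|²). Assume v = u at p₀, v_{η^{n+1}} ≠ 0 and u_{η^{n+1}} ≠ 0 at p₀, v ≥ u in U, W^v·(W^v(v)/√(1+|W^v(v)|²)) ≤ W^u·(W^u(u)/√(1+|W^u(u)|²)) in U, and either v or u has constant horizontal mean curvature (i.e., its operator value is a constant function on U). Then v ≡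 u near p₀. -/
open Set Finset

noncomputable section

/-- The `k`-th standard basis vector of `ℝ^N` (zero if `k ≥ N`). -/
def ee (N k : ℕ) : Fin N → ℝ := fun i => if (i : ℕ) = k then 1 else 0

/-- The `k`-th coordinate of a point of `ℝ^N` (zero if `k ≥ N`). -/
def cv (N k : ℕ) (x : Fin N → ℝ) : ℝ := if h : k < N then x ⟨k, h⟩ else 0

/-- The `k`-th partial derivative. -/
def pd (N k : ℕ) (f : (Fin N → ℝ) → ℝ) (x : Fin N → ℝ) : ℝ := fderiv ℝ f x (ee N k)

/-- Derivative of `f` along the vector field `X`. -/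
def vApp {N : ℕ} (X : (Fin N → ℝ) → (Fin N → ℝ)) (f : (Fin N → ℝ) → ℝ) (x : Fin N → ℝ) : ℝ :=
  fderiv ℝ f x (X x)

/-! Coordinates on `ℝ^{2n}` are `(η²,...,η^{2n},τ)`: the coordinate `η^j`
(for `2 ≤ j ≤ 2n`) is the entry of index `j − 2` and `τ` is the entry of
index `2n − 1`. -/

/-- The vector field `ê_j = ∂_{η^j} + η^{n+j}∂_τ`, for `2 ≤ j ≤ n`. -/
def eLow (n j : ℕ) : (Fin (2 * n) → ℝ) → (Fin (2 * n) → ℝ) :=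
  fun x => ee (2 * n) (j - 2) + cv (2 * n) (n + j - 2) x • ee (2 * n) (2 * n - 1)

/-- The vector field `ê_{n+j} = ∂_{η^{n+j}} − η^j∂_τ`, for `2 ≤ j ≤ n`. -/
def eHigh (n j : ℕ) : (Fin (2 * n) → ℝ) → (Fin (2 * n) → ℝ) :=
  fun x => ee (2 * n) (n + j - 2) - cv (2 * n) (j - 2) x • ee (2 * n) (2 * n - 1)

/-- The vector field `ê_{n+1}^w = ∂_{η^{n+1}} − 2w∂_τ`. -/
def eMid (n : ℕ) (w : (Fin (2 * n) → ℝ) → ℝ) : (Fin (2 * n) → ℝ) → (Fin (2 * n) → ℝ) :=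
  fun x => ee (2 * n) (n - 1) - (2 * w x) • ee (2 * n) (2 * n - 1)

/-- `1 + |W^w(w)|²`. -/
def Gq (n : ℕ) (w : (Fin (2 * n) → ℝ) → ℝ) (x : Fin (2 * n) → ℝ) : ℝ :=
  1 + (∑ j ∈ Finset.Icc 2 n, (vApp (eLow n j) w x) ^ 2)
    + (vApp (eMid n w) w x) ^ 2
    + (∑ j ∈ Finset.Icc 2 n, (vApp (eHigh n j) w x) ^ 2)

/-- The horizontal (p-)mean curvature operator of the intrinsic graph `w`:
`W^w·(W^w(w)/√(1+|W^w(w)|²))`. -/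
def Hintr (n : ℕ) (w : (Fin (2 * n) → ℝ) → ℝ) (x : Fin (2 * n) → ℝ) : ℝ :=
  (∑ j ∈ Finset.Icc 2 n,
      vApp (eLow n j) (fun y => vApp (eLow n j) w y / Real.sqrt (Gq n w y)) x)
    + vApp (eMid n w) (fun y => vApp (eMid n w) w y / Real.sqrt (Gq n w y)) x
    + (∑ j ∈ Finset.Icc 2 n,
        vApp (eHigh n j) (fun y => vApp (eHigh n j) w y / Real.sqrt (Gq n w y)) x)

open Filter Topology

lemma HasFDerivAt.div_sqrt {E : Type*} [NormedAddCommGroup E] [NormedSpace ℝ E]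
    {f g : E → ℝ} {f' g' : E →L[ℝ] ℝ} {x : E} (hf : HasFDerivAt f f' x)
    (hg : HasFDerivAt g g' x) (h : 0 < g x) :
    HasFDerivAt (fun y => f y / √(g y))
      ((1 / √(g x)) • f' - (f x / (2 * (g x * √(g x)))) • g') x := by
  have h1 := Real.sqrt_pos.2 h
  have h2 := Real.sq_sqrt h.le
  have := hf.mul ((hasDerivAt_inv h1.ne').comp_hasFDerivAt x (hg.sqrt h.ne'))
  refine this.congr_fderiv ?_
  ext y
  simp
  field_simp
  rw [h2]
  ring

/-- Vector fields `e i + (lam i x + c i * w x) • T` depending on an unknown function `w`. -/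
structure FieldData (E ι : Type*) [NormedAddCommGroup E] [NormedSpace ℝ E] where
  e : ι → E
  T : E
  lam : ι → E →L[ℝ] ℝ
  c : ι → ℝ

namespace FieldData
variable {E ι : Type*} [NormedAddCommGroup E] [NormedSpace ℝ E] [Fintype ι] (D : FieldData E ι)

/-- The field with index `i`, with the value of the unknown function replaced by `z`. -/
def fld (i : ι) (x : E) (z : ℝ) : E := D.e i + (D.lam i x + D.c i * z) • D.T

/-- `1 + |W w|²` as a function of the 1-jet of `w`. -/
def area (x : E) (z : ℝ) (l : E →L[ℝ] ℝ) : ℝ := 1 + ∑ j, (l (D.fld j x z)) ^ 2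

/-- The second derivative `X_i (X_j w)` as a function of the 2-jet of `w`. -/
def snd (i j : ι) (x : E) (z : ℝ) (l : E →L[ℝ] ℝ) (Q : E →L[ℝ] E →L[ℝ] ℝ) : ℝ :=
  Q (D.fld i x z) (D.fld j x z)
    + (D.lam j (D.fld i x z) + D.c j * l (D.fld i x z)) * l D.T

/-- The curvature operator as a function of the 2-jet of the unknown function. -/
def curvJet (J : E × ℝ × (E →L[ℝ] ℝ) × (E →L[ℝ] E →L[ℝ] ℝ)) : ℝ :=
  ∑ i, (D.snd i i J.1 J.2.1 J.2.2.1 J.2.2.2 / √(D.area J.1 J.2.1 J.2.2.1)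
    - J.2.2.1 (D.fld i J.1 J.2.1) *
      (∑ j, J.2.2.1 (D.fld j J.1 J.2.1) * D.snd i j J.1 J.2.1 J.2.2.1 J.2.2.2) /
        (D.area J.1 J.2.1 J.2.2.1 * √(D.area J.1 J.2.1 J.2.2.1)))

/-- The curvature operator built from the fields `D.fld i`. -/
def curv (w : E → ℝ) (x : E) : ℝ :=
  ∑ i, fderiv ℝ (fun y => fderiv ℝ w y (D.fld i y (w y)) / √(D.area y (w y) (fderiv ℝ w y))) x
    (D.fld i x (w x))

lemma area_pos (x : E) (z : ℝ) (l : E →L[ℝ] ℝ) : 0 < D.area x z l := by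
  unfold area; positivity

omit [Fintype ι] in
lemma hasFDerivAt_fld {w : E → ℝ} {x : E} (hw : DifferentiableAt ℝ w x) (i : ι) :
    HasFDerivAt (fun y => D.fld i y (w y))
      ((D.lam i + D.c i • fderiv ℝ w x).smulRight D.T) x := by
  unfold fld
  exact (((D.lam i).hasFDerivAt.add (hw.hasFDerivAt.const_mul (D.c i))).smul_const D.T).const_add _

lemma contDiff_curvJet : ContDiff ℝ 1 D.curvJet := by
  have h (J : E × ℝ × (E →L[ℝ] ℝ) × (E →L[ℝ] E →L[ℝ] ℝ)) := D.area_pos J.1 J.2.1 J.2.2.1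
  have h0 := fun J => (h J).ne'
  have h1 := fun J => (Real.sqrt_pos.2 (h J)).ne'
  have h2 := fun J => mul_ne_zero (h0 J) (h1 J)
  have ha : ContDiff ℝ 1 (fun J : E × ℝ × (E →L[ℝ] ℝ) × (E →L[ℝ] E →L[ℝ] ℝ) =>
      D.area J.1 J.2.1 J.2.2.1) := by
    unfold area fld; fun_prop
  have hs (i j : ι) : ContDiff ℝ 1 (fun J : E × ℝ × (E →L[ℝ] ℝ) × (E →L[ℝ] E →L[ℝ] ℝ) =>
      D.snd i j J.1 J.2.1 J.2.2.1 J.2.2.2) := by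
    unfold snd fld; fun_prop
  have hp (i : ι) : ContDiff ℝ 1 (fun J : E × ℝ × (E →L[ℝ] ℝ) × (E →L[ℝ] E →L[ℝ] ℝ) =>
      J.2.2.1 (D.fld i J.1 J.2.1)) := by
    unfold fld; fun_prop
  unfold curvJet
  refine ContDiff.sum fun i _ => ((hs i i).div (ha.sqrt h0) h1).sub
    (((hp i).mul (ContDiff.sum fun j _ => (hp j).mul (hs i j))).div (ha.mul (ha.sqrt h0)) h2)

lemma curv_eq_curvJet {w : E → ℝ} {x : E} (hw : ContDiffAt ℝ 2 w x) :
    D.curv w x = D.curvJet (x, w x, fderiv ℝ w x, fderiv ℝ (fderiv ℝ w) x) := by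
  have hd : DifferentiableAt ℝ w x := hw.differentiableAt (by norm_num)
  have hd2 : DifferentiableAt ℝ (fderiv ℝ w) x :=
    (hw.fderiv_right (m := 1) (by norm_num)).differentiableAt (by norm_num)
  have hp (i : ι) := hd2.hasFDerivAt.clm_apply (D.hasFDerivAt_fld hd i)
  have ha : HasFDerivAt (fun y => D.area y (w y) (fderiv ℝ w y)) _ x :=
    (HasFDerivAt.fun_sum (u := univ) fun j _ => (hp j).pow 2).const_add 1
  have h0 := D.area_pos x (w x) (fderiv ℝ w x)
  have h1 := Real.sqrt_pos.2 h0
  have h2 := Real.sq_sqrt h0.le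
  unfold curv curvJet
  refine Finset.sum_congr rfl fun i _ => ?_
  rw [(HasFDerivAt.div_sqrt (hp i) ha h0).fderiv]
  have hS (j : ι) : (fderiv ℝ w x ∘SL (D.lam j + D.c j • fderiv ℝ w x).smulRight D.T +
      (fderiv ℝ (fderiv ℝ w) x).flip (D.fld j x (w x))) (D.fld i x (w x))
      = D.snd i j x (w x) (fderiv ℝ w x) (fderiv ℝ (fderiv ℝ w) x) := by
    simp [snd]; ring
  simp only [sub_apply, smul_apply, _root_.sum_apply, hS, smul_eq_mul]
  have h3 : ∑ j, 2 • fderiv ℝ w x (D.fld j x (w x)) ^ (2 - 1) *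
        D.snd i j x (w x) (fderiv ℝ w x) (fderiv ℝ (fderiv ℝ w) x)
      = 2 * ∑ j, fderiv ℝ w x (D.fld j x (w x)) *
        D.snd i j x (w x) (fderiv ℝ w x) (fderiv ℝ (fderiv ℝ w) x) := by
    rw [Finset.mul_sum]
    exact Finset.sum_congr rfl fun j _ => by simp; ring
  rw [h3]
  field_simp

/-- Positivity of the principal part. -/
lemma sum_diag_le {P : E →L[ℝ] E →L[ℝ] ℝ} (hP : ∀ y, 0 ≤ P y y) (p : ι → ℝ) (X : ι → E) :
    ∑ i, P (X i) (X i) ≤ (1 + ∑ i, p i ^ 2) * ∑ i, P (X i) (X i)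
      - ∑ i, p i * ∑ j, p j * P (X i) (X j) := by
  have h : 0 ≤ ∑ i, ∑ j, P (p i • X j - p j • X i) (p i • X j - p j • X i) :=
    Finset.sum_nonneg fun i _ => Finset.sum_nonneg fun j _ => hP _
  have h' : ∑ i, ∑ j, P (p i • X j - p j • X i) (p i • X j - p j • X i)
      = 2 * ((∑ i, p i ^ 2) * ∑ i, P (X i) (X i)) - 2 * ∑ i, p i * ∑ j, p j * P (X i) (X j) := by
    have e (i j : ι) : P (p i • X j - p j • X i) (p i • X j - p j • X i)
        = p i ^ 2 * P (X j) (X j) + p j ^ 2 * P (X i) (X i)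
          - p i * (p j * P (X i) (X j)) - p j * (p i * P (X j) (X i)) := by
      simp only [map_sub, map_smul, sub_apply,
        smul_apply, smul_eq_mul]; ring
    simp only [e, Finset.sum_add_distrib, Finset.sum_sub_distrib]
    rw [Finset.sum_comm (f := fun i j => p j ^ 2 * P (X i) (X i)),
      Finset.sum_comm (f := fun i j => p j * (p i * P (X j) (X i)))]
    simp only [← Finset.mul_sum, ← Finset.sum_mul]
    ring
  nlinarith [h, h']

lemma curvJet_add_sub (x : E) (z : ℝ) (l : E →L[ℝ] ℝ) (Q P : E →L[ℝ] E →L[ℝ] ℝ) :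
    D.curvJet (x, z, l, Q + P) - D.curvJet (x, z, l, Q)
      = (D.area x z l * ∑ i, P (D.fld i x z) (D.fld i x z)
        - ∑ i, l (D.fld i x z) * ∑ j, l (D.fld j x z) * P (D.fld i x z) (D.fld j x z))
        / (D.area x z l * √(D.area x z l)) := by
  have h0 := D.area_pos x z l
  have h1 := Real.sqrt_pos.2 h0
  have hS (i j : ι) : D.snd i j x z l (Q + P)
      = D.snd i j x z l Q + P (D.fld i x z) (D.fld j x z) := by
    simp [snd]; ring
  simp only [curvJet, hS, mul_add, Finset.sum_add_distrib]
  rw [← Finset.sum_sub_distrib, Finset.mul_sum, ← Finset.sum_sub_distrib, Finset.sum_div]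
  refine Finset.sum_congr rfl fun i _ => ?_
  field_simp
  ring

lemma sum_diag_le_curvJet_sub (x : E) (z : ℝ) (l : E →L[ℝ] ℝ) (Q : E →L[ℝ] E →L[ℝ] ℝ)
    {P : E →L[ℝ] E →L[ℝ] ℝ} (hP : ∀ y, 0 ≤ P y y) :
    (∑ i, P (D.fld i x z) (D.fld i x z)) / (D.area x z l * √(D.area x z l))
      ≤ D.curvJet (x, z, l, Q + P) - D.curvJet (x, z, l, Q) := by
  have h0 := D.area_pos x z l
  have h1 := Real.sqrt_pos.2 h0
  have h := sum_diag_le hP (fun i => l (D.fld i x z)) (fun i => D.fld i x z)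
  rw [D.curvJet_add_sub, le_div_iff₀' (by positivity), mul_div_cancel₀ _ (by positivity)]
  exact h

end FieldData

lemma second_deriv_nonneg_of_isLocalMin {f : ℝ → ℝ} {a : ℝ} (h : IsLocalMin f a)
    (hc : ContDiffAt ℝ 2 f a) : 0 ≤ deriv (deriv f) a := by
  by_contra! hneg
  have hmax := isLocalMax_of_deriv_deriv_neg hneg h.deriv_eq_zero hc.continuousAt
  have he : f =ᶠ[𝓝 a] fun _ => f a := by
    filter_upwards [h, hmax] with y h1 h2 using le_antisymm h2 h1
  have := he.deriv.deriv_eq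
  simp at this
  linarith

lemma IsLocalMin.fderiv_fderiv_nonneg {E : Type*} [NormedAddCommGroup E] [NormedSpace ℝ E]
    {f : E → ℝ} {a : E} (h : IsLocalMin f a) (hc : ContDiffAt ℝ 2 f a) (y : E) :
    0 ≤ fderiv ℝ (fderiv ℝ f) a y y := by
  have hl' (t : ℝ) : HasDerivAt (fun t : ℝ => a + t • y) y t := by
    simpa using ((hasDerivAt_id t).smul_const y).const_add a
  have hcont : Tendsto (fun t : ℝ => a + t • y) (𝓝 0) (𝓝 a) := by
    have : Continuous fun t : ℝ => a + t • y := by fun_prop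
    simpa using this.tendsto 0
  have hmin : IsLocalMin (fun t : ℝ => f (a + t • y)) 0 := by
    have := hcont.eventually h
    simpa [IsLocalMin, IsMinFilter] using this
  have hc' : ContDiffAt ℝ 2 (fun t : ℝ => f (a + t • y)) 0 := by
    have : ContDiffAt ℝ 2 f (a + (0 : ℝ) • y) := by simpa using hc
    exact ContDiffAt.comp (g := f) (f := fun t : ℝ => a + t • y) (0 : ℝ) this (by fun_prop)
  have hd : ∀ᶠ x in 𝓝 a, DifferentiableAt ℝ f x := by
    filter_upwards [hc.eventually (by simp)] with x hx using hx.differentiableAt (by norm_num)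
  have h1 : deriv (fun t : ℝ => f (a + t • y)) =ᶠ[𝓝 0] fun t => fderiv ℝ f (a + t • y) y := by
    filter_upwards [hcont.eventually hd] with t ht
    exact (HasFDerivAt.comp_hasDerivAt (l := f) (f := fun t : ℝ => a + t • y) t ht.hasFDerivAt
      (hl' t)).deriv
  have hd2 : DifferentiableAt ℝ (fderiv ℝ f) (a + (0 : ℝ) • y) := by
    simpa using (hc.fderiv_right (m := 1) (by norm_num)).differentiableAt (by norm_num)
  have h2 : HasDerivAt (fun t : ℝ => fderiv ℝ f (a + t • y))
      (fderiv ℝ (fderiv ℝ f) (a + (0 : ℝ) • y) y) 0 :=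
    HasFDerivAt.comp_hasDerivAt (l := fderiv ℝ f) (f := fun t : ℝ => a + t • y) 0
      hd2.hasFDerivAt (hl' 0)
  have h3 := second_deriv_nonneg_of_isLocalMin hmin hc'
  have h4 := (h2.clm_apply (hasDerivAt_const (0 : ℝ) y)).deriv
  rw [h1.deriv_eq, h4] at h3
  simpa using h3

namespace FieldData
variable {E ι : Type*} [NormedAddCommGroup E] [NormedSpace ℝ E] [Fintype ι] (D : FieldData E ι)

/-- The 2-jet of `w` at `x`. -/
def jet (w : E → ℝ) (x : E) : E × ℝ × (E →L[ℝ] ℝ) × (E →L[ℝ] E →L[ℝ] ℝ) :=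
  (x, w x, fderiv ℝ w x, fderiv ℝ (fderiv ℝ w) x)

lemma continuousAt_jet {w : E → ℝ} {x : E} (hw : ContDiffAt ℝ 2 w x) :
    ContinuousAt (jet w) x := by
  have h1 := (hw.fderiv_right (m := 1) (by norm_num))
  exact continuousAt_id.prodMk (hw.continuousAt.prodMk (h1.continuousAt.prodMk
    (h1.fderiv_right (m := 0) (by norm_num)).continuousAt))

/-- If `v - u - ε h` has a local minimum at `x`, then the curvature of `v` at `x` dominates the
curvature operator evaluated at the 2-jet of `u + ε h`, with the actual value of `v`. -/
lemma curvJet_le_curv_of_isLocalMin {u v h : E → ℝ} {x : E} {ε : ℝ}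
    (hu : ContDiffAt ℝ 2 u x) (hv : ContDiffAt ℝ 2 v x) (hh : ContDiffAt ℝ 2 h x)
    (hmin : IsLocalMin (fun y => v y - u y - ε * h y) x) :
    D.curvJet (x, v x, fderiv ℝ u x + ε • fderiv ℝ h x,
      fderiv ℝ (fderiv ℝ u) x + ε • fderiv ℝ (fderiv ℝ h) x) ≤ D.curv v x := by
  have hc : ContDiffAt ℝ 2 (fun y => v y - u y - ε * h y) x :=
    (hv.sub hu).sub (contDiffAt_const.mul hh)
  have hev {w : E → ℝ} (hw : ContDiffAt ℝ 2 w x) : ∀ᶠ y in 𝓝 x, DifferentiableAt ℝ w y := by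
    filter_upwards [hw.eventually (by simp)] with y hy using hy.differentiableAt (by norm_num)
  have hd : fderiv ℝ (fun y => v y - u y - ε * h y) =ᶠ[𝓝 x]
      fun y => fderiv ℝ v y - fderiv ℝ u y - ε • fderiv ℝ h y := by
    filter_upwards [hev hu, hev hv, hev hh] with y h1 h2 h3
    exact ((h2.hasFDerivAt.sub h1.hasFDerivAt).sub (h3.hasFDerivAt.const_mul ε)).fderiv
  have hd2 {w : E → ℝ} (hw : ContDiffAt ℝ 2 w x) : HasFDerivAt (fderiv ℝ w) _ x :=
    ((hw.fderiv_right (m := 1) (by norm_num)).differentiableAt (by norm_num)).hasFDerivAt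
  have h0 := hmin.fderiv_eq_zero
  rw [hd.eq_of_nhds] at h0
  have h1 : fderiv ℝ u x + ε • fderiv ℝ h x = fderiv ℝ v x := by
    rw [sub_sub, sub_eq_zero] at h0; exact h0.symm
  have hP := hmin.fderiv_fderiv_nonneg hc
  have hd3 : HasFDerivAt (fun y => fderiv ℝ v y - fderiv ℝ u y - ε • fderiv ℝ h y) _ x :=
    ((hd2 hv).sub (hd2 hu)).sub ((hd2 hh).const_smul ε)
  rw [hd.fderiv_eq, hd3.fderiv] at hP
  have := D.sum_diag_le_curvJet_sub x (v x) (fderiv ℝ v x)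
    (fderiv ℝ (fderiv ℝ u) x + ε • fderiv ℝ (fderiv ℝ h) x) hP
  rw [D.curv_eq_curvJet hv, h1]
  have h0 := D.area_pos x (v x) (fderiv ℝ v x)
  have h2 := (div_nonneg (Finset.sum_nonneg fun i _ => hP (D.fld i x (v x)))
    (by positivity : 0 ≤ D.area x (v x) (fderiv ℝ v x) * √(D.area x (v x) (fderiv ℝ v x)))).trans this
  have h3 : fderiv ℝ (fderiv ℝ u) x + ε • fderiv ℝ (fderiv ℝ h) x +
      (fderiv ℝ (fderiv ℝ v) x - fderiv ℝ (fderiv ℝ u) x - ε • fderiv ℝ (fderiv ℝ h) x)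
      = fderiv ℝ (fderiv ℝ v) x := by abel
  rw [h3] at h2
  linarith

/-- Finite differences of a strictly differentiable function along a convergent sequence. -/
lemma _root_.HasStrictFDerivAt.apply_nonpos_of_tendsto {F : Type*} [NormedAddCommGroup F]
    [NormedSpace ℝ F] {f : F → ℝ} {f' : F →L[ℝ] ℝ} {a k : F} (hf : HasStrictFDerivAt f f' a)
    {J K : ℕ → F} {ε : ℕ → ℝ} (hJ : Tendsto J atTop (𝓝 a)) (hK : Tendsto K atTop (𝓝 k))
    (hε : Tendsto ε atTop (𝓝 0)) (hpos : ∀ m, 0 < ε m)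
    (hle : ∀ᶠ m in atTop, f (J m + ε m • K m) ≤ f (J m)) : f' k ≤ 0 := by
  have hJ' : Tendsto (fun m => J m + ε m • K m) atTop (𝓝 a) := by
    simpa using hJ.add (hε.smul hK)
  have ho := hf.isLittleO.comp_tendsto (hJ'.prodMk_nhds hJ)
  have hO : (fun m => ε m • K m) =O[atTop] fun m => ε m := by
    have := (Asymptotics.isBigO_refl ε atTop).smul (hK.isBigO_one ℝ)
    simpa using this
  have ho' : (fun m => f (J m + ε m • K m) - f (J m) - f' (ε m • K m)) =o[atTop] fun m => ε m := by
    refine Asymptotics.IsLittleO.trans_isBigO ?_ hO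
    simpa [Function.comp_def] using ho
  have hl := ho'.tendsto_div_nhds_zero.neg
  rw [neg_zero] at hl
  refine le_of_tendsto_of_tendsto ((f'.continuous.tendsto k).comp hK) hl ?_
  filter_upwards [hle] with m hm
  have := hpos m
  simp only [Function.comp_apply, map_smul, smul_eq_mul]
  rw [← neg_div, le_div_iff₀ this]
  linarith

omit [NormedSpace ℝ E] in
/-- Sequence of approximate touching points. -/
lemma exists_seq_isLocalMin [ProperSpace E] {φ h : E → ℝ} {U : Set E} (hU : IsOpen U)
    {p : E} (hp : p ∈ U) (hφ : ContinuousOn φ U) (hh : Continuous h)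
    (hφ0 : ∀ x ∈ U, 0 ≤ φ x) (hφp : φ p = 0) (hhp : h p = 0)
    (hneg : ∀ᶠ x in 𝓝 p, φ x = 0 → x ≠ p → h x < 0)
    {ε : ℕ → ℝ} (hε : Tendsto ε atTop (𝓝 0)) (hpos : ∀ m, 0 < ε m) :
    ∃ X : ℕ → E, Tendsto X atTop (𝓝 p) ∧ (∀ᶠ m in atTop, φ (X m) ≤ ε m * h (X m)) ∧
      ∀ᶠ m in atTop, IsLocalMin (fun y => φ y - ε m * h y) (X m) := by
  obtain ⟨r, hr, hrU⟩ := Metric.nhds_basis_closedBall.mem_iff.1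
    (Filter.inter_mem (hU.mem_nhds hp) hneg)
  have hB : IsCompact (Metric.closedBall p r) := isCompact_closedBall p r
  have hBU : Metric.closedBall p r ⊆ U := fun x hx => (hrU hx).1
  have hpB : p ∈ Metric.closedBall p r := Metric.mem_closedBall_self hr.le
  have hex (m : ℕ) : ∃ x ∈ Metric.closedBall p r,
      IsMinOn (fun y => φ y - ε m * h y) (Metric.closedBall p r) x :=
    hB.exists_isMinOn ⟨p, hpB⟩ ((hφ.mono hBU).sub (by fun_prop))
  choose X hXB hXmin using hex
  have hle (m : ℕ) : φ (X m) ≤ ε m * h (X m) := by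
    have := isMinOn_iff.1 (hXmin m) p hpB
    simp only [hφp, hhp, mul_zero, sub_zero] at this
    linarith
  have hlim : Tendsto X atTop (𝓝 p) := by
    refine hB.tendsto_nhds_of_unique_mapClusterPt (Eventually.of_forall hXB) fun x hx hcl => ?_
    obtain ⟨ψ, hψ, hψx⟩ := hcl.tendsto_subseq
    have hφx : Tendsto (fun m => φ (X (ψ m))) atTop (𝓝 (φ x)) :=
      ((hφ.continuousAt (hU.mem_nhds (hBU hx))).tendsto).comp hψx
    have hhx : Tendsto (fun m => h (X (ψ m))) atTop (𝓝 (h x)) := (hh.tendsto x).comp hψx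
    have hεψ : Tendsto (fun m => ε (ψ m)) atTop (𝓝 0) := hε.comp hψ.tendsto_atTop
    have h1 : φ x ≤ 0 * h x := le_of_tendsto_of_tendsto' hφx (hεψ.mul hhx) fun m => hle _
    have h2 : 0 ≤ h x := ge_of_tendsto' hhx fun m => by
      have := (hφ0 _ (hBU (hXB (ψ m)))).trans (hle _)
      exact nonneg_of_mul_nonneg_right this (hpos _)
    by_contra hne
    have := (hrU hx).2 (le_antisymm (by simpa using h1) (hφ0 _ (hBU hx))) hne
    linarith
  refine ⟨X, hlim, Eventually.of_forall hle, ?_⟩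
  filter_upwards [hlim.eventually (Metric.ball_mem_nhds p hr)] with m hm
  exact (hXmin m).isLocalMin (mem_of_superset (Metric.isOpen_ball.mem_nhds hm)
    Metric.ball_subset_closedBall)

set_option maxSynthPendingDepth 6 in
/-- The linearized operator is nonpositive on a barrier touching the contact set. -/
lemma fderiv_curvJet_nonpos [ProperSpace E] {u v h : E → ℝ} {U : Set E} (hU : IsOpen U)
    {p : E} (hp : p ∈ U) (hu : ContDiffOn ℝ 2 u U) (hv : ContDiffOn ℝ 2 v U)
    (huv : ∀ x ∈ U, u x ≤ v x) (hH : ∀ x ∈ U, D.curv v x ≤ D.curv u x) (hpuv : v p = u p)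
    (hh : ContDiff ℝ 2 h) (hhp : h p = 0)
    (hneg : ∀ᶠ x in 𝓝 p, v x = u x → x ≠ p → h x < 0) :
    fderiv ℝ D.curvJet (jet u p) (0, 0, fderiv ℝ h p, fderiv ℝ (fderiv ℝ h) p) ≤ 0 := by
  have hε : Tendsto (fun m : ℕ => 1 / ((m : ℝ) + 1)) atTop (𝓝 0) :=
    tendsto_one_div_add_atTop_nhds_zero_nat
  have hpos (m : ℕ) : 0 < 1 / ((m : ℝ) + 1) := by positivity
  obtain ⟨X, hX, hle, hmin⟩ := exists_seq_isLocalMin (φ := fun x => v x - u x) hU hp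
    (hv.continuousOn.sub hu.continuousOn) hh.continuous (fun x hx => sub_nonneg.2 (huv x hx))
    (sub_eq_zero.2 hpuv) hhp (by simpa only [sub_eq_zero] using hneg) hε hpos
  have hXU : ∀ᶠ m in atTop, X m ∈ U := hX.eventually (hU.mem_nhds hp)
  have hjet {w : E → ℝ} (hw : ContDiffAt ℝ 2 w p) :
      Tendsto (fun m => jet w (X m)) atTop (𝓝 (jet w p)) := (continuousAt_jet hw).tendsto.comp hX
  have hjh := hjet hh.contDiffAt
  have hq : Tendsto (fun m : ℕ => (v (X m) - u (X m)) / (1 / ((m : ℝ) + 1))) atTop (𝓝 0) := by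
    have hhX : Tendsto (fun m => h (X m)) atTop (𝓝 0) := by
      simpa [hhp, Function.comp_def] using (hh.continuous.tendsto p).comp hX
    refine tendsto_of_tendsto_of_tendsto_of_le_of_le' tendsto_const_nhds hhX ?_ ?_
    · filter_upwards [hXU] with m hm
      exact div_nonneg (sub_nonneg.2 (huv _ hm)) (hpos m).le
    · filter_upwards [hle] with m hm
      rw [div_le_iff₀ (hpos m), mul_comm]
      exact hm
  have hK : Tendsto (fun m : ℕ => ((0 : E), (v (X m) - u (X m)) / (1 / ((m : ℝ) + 1)),
      fderiv ℝ h (X m), fderiv ℝ (fderiv ℝ h) (X m))) atTop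
      (𝓝 (0, 0, fderiv ℝ h p, fderiv ℝ (fderiv ℝ h) p)) :=
    tendsto_const_nhds.prodMk_nhds (hq.prodMk_nhds hjh.snd_nhds.snd_nhds)
  refine (D.contDiff_curvJet.contDiffAt.hasStrictFDerivAt (by norm_num)).apply_nonpos_of_tendsto
    (hjet (hu.contDiffAt (hU.mem_nhds hp))) hK hε hpos ?_
  filter_upwards [hXU, hmin] with m hm hmin
  have hum := hu.contDiffAt (hU.mem_nhds hm)
  have h1 := D.curvJet_le_curv_of_isLocalMin hum (hv.contDiffAt (hU.mem_nhds hm))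
    hh.contDiffAt hmin
  have h2 := D.curv_eq_curvJet hum
  have e : jet u (X m) + (1 / ((m : ℝ) + 1)) • ((0 : E), (v (X m) - u (X m)) / (1 / ((m : ℝ) + 1)),
      fderiv ℝ h (X m), fderiv ℝ (fderiv ℝ h) (X m))
      = (X m, v (X m), fderiv ℝ u (X m) + (1 / ((m : ℝ) + 1)) • fderiv ℝ h (X m),
        fderiv ℝ (fderiv ℝ u) (X m) + (1 / ((m : ℝ) + 1)) • fderiv ℝ (fderiv ℝ h) (X m)) := by
    simp only [jet, Prod.smul_mk, Prod.mk_add_mk, smul_zero, add_zero, smul_eq_mul,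
      mul_div_cancel₀ _ (hpos m).ne', add_sub_cancel]
  rw [e]
  exact h1.trans ((hH _ hm).trans h2.le)

set_option maxSynthPendingDepth 6 in
/-- Hopf-type lemma: the fields are tangent to any level set touching the contact set. -/
theorem fderiv_apply_fld_eq_zero [ProperSpace E] {u v γ : E → ℝ} {U : Set E} (hU : IsOpen U)
    {p : E} (hp : p ∈ U) (hu : ContDiffOn ℝ 2 u U) (hv : ContDiffOn ℝ 2 v U)
    (huv : ∀ x ∈ U, u x ≤ v x) (hH : ∀ x ∈ U, D.curv v x ≤ D.curv u x) (hpuv : v p = u p)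
    (hγ : ContDiff ℝ 2 γ) (hγp : γ p = 0)
    (hneg : ∀ᶠ x in 𝓝 p, v x = u x → x ≠ p → γ x < 0) (i : ι) :
    fderiv ℝ γ p (D.fld i p (u p)) = 0 := by
  set l := fderiv ℝ γ p with hl
  set P : E →L[ℝ] E →L[ℝ] ℝ := l.smulRight l with hP
  set Q := fderiv ℝ (fderiv ℝ γ) p with hQ
  set L := fderiv ℝ D.curvJet (jet u p) with hL
  have hγd (x : E) : HasFDerivAt γ (fderiv ℝ γ x) x :=
    (hγ.differentiable (by norm_num) x).hasFDerivAt
  have hγd2 : HasFDerivAt (fderiv ℝ γ) Q p :=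
    ((hγ.fderiv_right (m := 1) (by norm_num)).differentiable (by norm_num) p).hasFDerivAt
  have key (α : ℝ) (hα : 0 < α) : L (0, 0, l, Q) + (2 * α) * L (0, 0, 0, P) ≤ 0 := by
    have hd (x : E) : HasFDerivAt (fun x => γ x + α * γ x ^ 2)
        ((1 + 2 * α * γ x) • fderiv ℝ γ x) x := by
      refine ((hγd x).add (((hγd x).pow 2).const_mul α)).congr_fderiv ?_
      ext y; simp; ring
    have hf : fderiv ℝ (fun x => γ x + α * γ x ^ 2)
        = fun x => (1 + 2 * α * γ x) • fderiv ℝ γ x := funext fun x => (hd x).fderiv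
    have hf2 : fderiv ℝ (fderiv ℝ (fun x => γ x + α * γ x ^ 2)) p = Q + (2 * α) • P := by
      rw [hf]
      refine (((((hγd p).const_mul (2 * α)).const_add 1).smul hγd2).congr_fderiv ?_).fderiv
      ext y z; simp [hγp, hP, hl]; ring
    have hsmall : ∀ᶠ x in 𝓝 p, 0 < 1 + α * γ x := by
      have : Continuous fun x => 1 + α * γ x := by have := hγ.continuous; fun_prop
      exact this.continuousAt.eventually (lt_mem_nhds (by simp [hγp]))
    have := D.fderiv_curvJet_nonpos (h := fun x => γ x + α * γ x ^ 2) hU hp hu hv huv hH hpuv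
      (by fun_prop) (by simp [hγp]) (by
        filter_upwards [hneg, hsmall] with x h1 h2 h3 h4
        have := mul_neg_of_neg_of_pos (h1 h3 h4) h2
        linarith)
    rw [hf2, hf] at this
    have e : ((0 : E), (0 : ℝ), (1 + 2 * α * γ p) • fderiv ℝ γ p, Q + (2 * α) • P)
        = (0, 0, l, Q) + (2 * α) • ((0 : E), (0 : ℝ), (0 : E →L[ℝ] ℝ), P) := by
      simp [hγp, hl]
    rw [e, map_add, map_smul, smul_eq_mul] at this
    exact this
  have hLP : L (0, 0, 0, P) ≤ 0 := by
    by_contra! hc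
    have := key ((|L (0, 0, l, Q)| + 1) / (2 * L (0, 0, 0, P))) (by positivity)
    have e : 2 * ((|L (0, 0, l, Q)| + 1) / (2 * L (0, 0, 0, P))) * L (0, 0, 0, P)
        = |L (0, 0, l, Q)| + 1 := by field_simp
    rw [e] at this
    linarith [neg_abs_le (L (0, 0, l, Q))]
  set a := D.area p (u p) (fderiv ℝ u p) with ha
  have ha0 : 0 < a := D.area_pos _ _ _
  have hpsd (t : ℝ) (ht : 0 ≤ t) (y : E) : 0 ≤ (t • P) y y := by
    simp [hP]; exact mul_nonneg ht (mul_self_nonneg _)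
  have hder : HasDerivAt (fun t : ℝ => D.curvJet (jet u p + t • ((0 : E), (0 : ℝ),
      (0 : E →L[ℝ] ℝ), P))) (L (0, 0, 0, P)) 0 := by
    have h1 : HasFDerivAt D.curvJet L (jet u p + (0 : ℝ) • ((0 : E), (0 : ℝ),
        (0 : E →L[ℝ] ℝ), P)) := by
      rw [zero_smul, add_zero]
      exact (D.contDiff_curvJet.differentiable (by norm_num) _).hasFDerivAt
    have h2 := ((hasDerivAt_id (0 : ℝ)).smul_const ((0 : E), (0 : ℝ),
        (0 : E →L[ℝ] ℝ), P)).const_add (jet u p)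
    rw [one_smul] at h2
    exact HasFDerivAt.comp_hasDerivAt (l := D.curvJet) (f := fun t : ℝ => jet u p + t • ((0 : E), (0 : ℝ),
      (0 : E →L[ℝ] ℝ), P)) 0 h1 h2
  have hlower : (∑ i, P (D.fld i p (u p)) (D.fld i p (u p))) / (a * √a) ≤ L (0, 0, 0, P) := by
    have hs := (hasDerivAt_iff_tendsto_slope_zero.1 hder).mono_left
      (nhdsGT_le_nhdsNE (0 : ℝ))
    refine ge_of_tendsto hs ?_
    filter_upwards [self_mem_nhdsWithin] with t ht
    have ht : (0 : ℝ) < t := ht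
    have := D.sum_diag_le_curvJet_sub p (u p) (fderiv ℝ u p) (fderiv ℝ (fderiv ℝ u) p)
      (hpsd t ht.le)
    simp only [smul_apply, smul_eq_mul, ← Finset.mul_sum] at this
    rw [mul_div_assoc] at this
    simp only [zero_add, zero_smul, add_zero, smul_eq_mul]
    rw [inv_mul_eq_div, le_div_iff₀' ht]
    simpa [jet] using this
  have hsum : ∑ i, P (D.fld i p (u p)) (D.fld i p (u p)) ≤ 0 := by
    have h1 : 0 < a * √a := mul_pos ha0 (Real.sqrt_pos.2 ha0)
    have := hlower.trans hLP
    rwa [div_le_iff₀ h1, zero_mul] at this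
  have hz := (Finset.sum_eq_zero_iff_of_nonneg (fun j _ => by
    simpa using hpsd 1 zero_le_one (D.fld j p (u p)))).1
    (le_antisymm hsum (Finset.sum_nonneg fun j _ => by
      simpa using hpsd 1 zero_le_one (D.fld j p (u p)))) i (Finset.mem_univ i)
  simpa [hP] using hz

end FieldData

/-- A vector field `X` is tangent to `F` if every `C^2` function that has a local minimum on `F`
at a point of `F` has zero derivative along `X` there. -/
def TangentTo {N : ℕ} (F : Set (Fin N → ℝ)) (X : (Fin N → ℝ) → (Fin N → ℝ)) : Prop :=
  ∀ p ∈ F, ∀ γ : (Fin N → ℝ) → ℝ, ContDiff ℝ 2 γ → IsLocalMinOn γ F p → fderiv ℝ γ p (X p) = 0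

lemma TangentTo.eq_zero_of_hasDerivAt {N : ℕ} {F : Set (Fin N → ℝ)}
    {X : (Fin N → ℝ) → (Fin N → ℝ)} (hX : TangentTo F X) {p : Fin N → ℝ} (hp : p ∈ F)
    {γ : (Fin N → ℝ) → ℝ} (hγ : ContDiff ℝ 2 γ) (hmin : IsLocalMinOn γ F p) {d : ℝ}
    (hd : HasDerivAt (fun s : ℝ => γ (p + s • X p)) d 0) : d = 0 := by
  have h1 : HasFDerivAt γ (fderiv ℝ γ p) (p + (0 : ℝ) • X p) := by
    rw [zero_smul, add_zero]
    exact (hγ.differentiable (by norm_num) p).hasFDerivAt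
  have h2 : HasDerivAt (fun s : ℝ => p + s • X p) (X p) 0 := by
    simpa using ((hasDerivAt_id (0 : ℝ)).smul_const (X p)).const_add p
  rw [← hX p hp γ hγ hmin]
  exact hd.unique (HasFDerivAt.comp_hasDerivAt (l := γ) (f := fun s : ℝ => p + s • X p) 0 h1 h2)

/-- The field `∂_k + c x_l ∂_τ`. -/
def shearField {N : ℕ} (k l τ : Fin N) (c : ℝ) (x : Fin N → ℝ) : Fin N → ℝ :=
  Pi.single k 1 + (c * x l) • Pi.single τ 1

/-- A minimizer over a locally closed set, when the sublevel set stays inside a ball. -/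
lemma exists_isLocalMinOn {E : Type*} [MetricSpace E] [ProperSpace E] {F : Set E} {z x₀ : E} {r : ℝ}
    (hF : IsClosed (F ∩ Metric.closedBall z r)) {g : E → ℝ} (hg : Continuous g)
    (hx₀ : x₀ ∈ F) (hx₀' : x₀ ∈ Metric.closedBall z r)
    (hsub : ∀ x ∈ Metric.closedBall z r, g x ≤ g x₀ → x ∈ Metric.ball z r) :
    ∃ p ∈ F, g p ≤ g x₀ ∧ IsLocalMinOn g F p ∧ p ∈ Metric.closedBall z r := by
  have hc : IsCompact (F ∩ Metric.closedBall z r) :=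
    (isCompact_closedBall z r).of_isClosed_subset hF Set.inter_subset_right
  obtain ⟨p, ⟨hpF, hpB⟩, hp⟩ := hc.exists_isMinOn ⟨x₀, hx₀, hx₀'⟩ hg.continuousOn
  have hle : g p ≤ g x₀ := isMinOn_iff.1 hp _ ⟨hx₀, hx₀'⟩
  refine ⟨p, hpF, hle, ?_, hpB⟩
  have hb := Metric.isOpen_ball.mem_nhds (hsub p hpB hle)
  filter_upwards [self_mem_nhdsWithin, nhdsWithin_le_nhds hb] with x hxF hxB
  exact isMinOn_iff.1 hp x ⟨hxF, Metric.ball_subset_closedBall hxB⟩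

/-- A set to which a shear field is tangent contains the integral segments of that field. -/
lemma TangentTo.segment_mem {N : ℕ} {F : Set (Fin N → ℝ)} {k l τ : Fin N} (hkl : k ≠ l)
    (hkτ : k ≠ τ) (hlτ : l ≠ τ) {c : ℝ} (hT : TangentTo F (shearField k l τ c))
    {x₀ z : Fin N → ℝ} (hx₀ : x₀ ∈ F) {t r : ℝ} (hz : z = x₀ + t • shearField k l τ c x₀)
    (hcl : IsClosed (F ∩ Metric.closedBall z r))
    (hr : |t| * (1 + |c| * (|z l| + |t|)) < r) : z ∈ F := by
  have hr0 : 0 < r := lt_of_le_of_lt (by positivity) hr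
  have htr : |t| < r := lt_of_le_of_lt (le_mul_of_one_le_right (abs_nonneg t)
    (le_add_of_nonneg_right (by positivity))) hr
  have hzk : z k = x₀ k + t := by simp [hz, shearField, hkτ]
  have hzl : z l = x₀ l := by simp [hz, shearField, hlτ, hkl.symm]
  have hzτ : z τ = x₀ τ + t * (c * x₀ l) := by simp [hz, shearField, hkτ.symm]
  have hzi (i : Fin N) (h1 : i ≠ k) (h2 : i ≠ τ) : z i = x₀ i := by
    simp [hz, shearField, h1, h2]
  suffices h : ∀ δ : ℝ, 0 < δ → δ ≤ 1 → ∃ p ∈ F ∩ Metric.closedBall z r, dist z p ≤ δ * |t| by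
    have : z ∈ closure (F ∩ Metric.closedBall z r) := by
      refine Metric.mem_closure_iff.2 fun ε hε => ?_
      obtain ⟨p, hp, hd⟩ := h (min 1 (ε / (2 * (|t| + 1)))) (by positivity) (min_le_left _ _)
      refine ⟨p, hp, hd.trans_lt ?_⟩
      calc min 1 (ε / (2 * (|t| + 1))) * |t| ≤ ε / (2 * (|t| + 1)) * (|t| + 1) := by
            gcongr
            · exact min_le_right _ _
            · linarith
        _ = ε / 2 := by field_simp
        _ < ε := by linarith
    rw [hcl.closure_eq] at this
    exact this.1
  intro δ hδ hδ1
  set S := Finset.univ.filter (fun i : Fin N => i ≠ k ∧ i ≠ τ) with hS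
  set g : (Fin N → ℝ) → ℝ := fun x => δ ^ 2 * (x k - z k) ^ 2 + ∑ i ∈ S, (x i - z i) ^ 2
    + (x τ - z τ - c * (x k - z k) * x l) ^ 2 with hg
  have hgc : ContDiff ℝ 2 g := by rw [hg]; fun_prop
  have hg0 : g x₀ = (δ * |t|) ^ 2 := by
    have : ∑ i ∈ S, (x₀ i - z i) ^ 2 = 0 := Finset.sum_eq_zero fun i hi => by
      simp only [hS, Finset.mem_filter] at hi
      rw [hzi i hi.2.1 hi.2.2]; ring
    simp only [hg, this, hzk, hzτ]
    rw [mul_pow, sq_abs]; ring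
  have hbound {x : Fin N → ℝ} (hx : g x ≤ g x₀) : |x k - z k| ≤ |t| ∧
      (∀ i, i ≠ k → i ≠ τ → |x i - z i| ≤ δ * |t|) ∧
      |x τ - z τ - c * (x k - z k) * x l| ≤ δ * |t| := by
    have hs : 0 ≤ ∑ i ∈ S, (x i - z i) ^ 2 := Finset.sum_nonneg fun i _ => sq_nonneg _
    rw [hg0] at hx
    simp only [hg] at hx
    have h1 := sq_nonneg (x τ - z τ - c * (x k - z k) * x l)
    have h2 := mul_nonneg (sq_nonneg δ) (sq_nonneg (x k - z k))
    refine ⟨?_, fun i hik hiτ => ?_, abs_le_of_sq_le_sq (by linarith) (by positivity)⟩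
    · refine abs_le_of_sq_le_sq ?_ (abs_nonneg _)
      have : δ ^ 2 * (x k - z k) ^ 2 ≤ δ ^ 2 * |t| ^ 2 := by rw [← mul_pow δ |t|]; linarith
      exact le_of_mul_le_mul_left this (by positivity)
    · have h3 := Finset.single_le_sum (f := fun i => (x i - z i) ^ 2) (fun i _ => sq_nonneg _)
        (show i ∈ S by simp [hS, hik, hiτ])
      exact abs_le_of_sq_le_sq (by linarith) (by positivity)
  have hδt : δ * |t| ≤ |t| := mul_le_of_le_one_left (abs_nonneg t) hδ1
  have hball {x : Fin N → ℝ} (hx : g x ≤ g x₀) : x ∈ Metric.ball z r := by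
    obtain ⟨h1, h2, h3⟩ := hbound hx
    rw [Metric.mem_ball, dist_pi_lt_iff hr0]
    intro i
    rw [Real.dist_eq]
    by_cases hik : i = k
    · subst hik; linarith
    by_cases hiτ : i = τ
    · subst hiτ
      have hl := h2 l hkl.symm hlτ
      have hl' : |x l| ≤ |z l| + |t| := by
        have := abs_add_le (x l - z l) (z l)
        rw [sub_add_cancel] at this
        linarith
      have h4 : |c * (x k - z k) * x l| ≤ |c| * |t| * (|z l| + |t|) := by
        rw [abs_mul, abs_mul]; gcongr
      have h5 := abs_add_le (x i - z i - c * (x k - z k) * x l) (c * (x k - z k) * x l)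
      rw [sub_add_cancel] at h5
      have h6 : |t| * (1 + |c| * (|z l| + |t|)) = |t| + |c| * |t| * (|z l| + |t|) := by ring
      linarith
    · linarith [h2 i hik hiτ]
  obtain ⟨p, hpF, hple, hpmin, hpB⟩ := exists_isLocalMinOn hcl hgc.continuous hx₀
    (Metric.ball_subset_closedBall (hball le_rfl)) fun x _ hx => hball hx
  have hd : HasDerivAt (fun s : ℝ => g (p + s • shearField k l τ c p))
      (2 * δ ^ 2 * (p k - z k)) 0 := by
    have e : (fun s : ℝ => g (p + s • shearField k l τ c p)) = fun s =>
        δ ^ 2 * (p k - z k + s) ^ 2 + (∑ i ∈ S, (p i - z i) ^ 2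
          + (p τ - z τ - c * (p k - z k) * p l) ^ 2) := by
      funext s
      have e1 : ∑ i ∈ S, ((p + s • shearField k l τ c p) i - z i) ^ 2
          = ∑ i ∈ S, (p i - z i) ^ 2 := Finset.sum_congr rfl fun i hi => by
        simp only [hS, Finset.mem_filter] at hi
        simp [shearField, hi.2.1, hi.2.2]
      simp only [hg, e1]
      simp [shearField, hkτ, hkτ.symm, hkl.symm, hlτ]
      ring
    rw [e]
    refine (((((hasDerivAt_id (0 : ℝ)).const_add (p k - z k)).pow 2).const_mul
      (δ ^ 2)).add_const _).congr_deriv ?_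
    simp; ring
  have hk : p k = z k := by
    have := hT.eq_zero_of_hasDerivAt hpF hgc hpmin hd
    have h2 : 2 * δ ^ 2 ≠ 0 := by positivity
    exact sub_eq_zero.1 ((mul_eq_zero.1 this).resolve_left h2)
  obtain ⟨-, h2, h3⟩ := hbound hple
  refine ⟨p, ⟨hpF, hpB⟩, ?_⟩
  rw [dist_comm, dist_pi_le_iff (by positivity)]
  intro i
  rw [Real.dist_eq]
  by_cases hik : i = k
  · subst hik; rw [hk, sub_self, abs_zero]; positivity
  by_cases hiτ : i = τ
  · subst hiτ; simpa [hk] using h3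
  · exact h2 i hik hiτ

/-- Uniform version of `TangentTo.segment_mem` near a point. -/
lemma TangentTo.exists_uniform_segment {N : ℕ} {F : Set (Fin N → ℝ)} {k l τ : Fin N} (hkl : k ≠ l)
    (hkτ : k ≠ τ) (hlτ : l ≠ τ) {c : ℝ} (hT : TangentTo F (shearField k l τ c))
    (p : Fin N → ℝ) {R : ℝ} (hR : 0 < R)
    (hcl : ∀ z ∈ Metric.ball p R, IsClosed (F ∩ Metric.closedBall z R)) :
    ∃ ρ > 0, ∀ x₀ ∈ F, ∀ t : ℝ, |t| < ρ →
      x₀ + t • shearField k l τ c x₀ ∈ Metric.ball p R →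
        x₀ + t • shearField k l τ c x₀ ∈ F := by
  set M := 1 + |c| * (|p l| + R + 1) with hM
  have hM0 : 0 < M := by positivity
  refine ⟨min 1 (R / M), by positivity, fun x₀ hx₀ t ht hz => ?_⟩
  refine hT.segment_mem hkl hkτ hlτ hx₀ rfl (hcl _ hz) ?_
  set z := x₀ + t • shearField k l τ c x₀
  have h1 : |t| ≤ 1 := (ht.trans_le (min_le_left _ _)).le
  have h2 : |t| < R / M := ht.trans_le (min_le_right _ _)
  have h3 : |z l| ≤ |p l| + R := by
    have h4 : |z l - p l| < R := by
      have := (dist_le_pi_dist z p l).trans_lt hz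
      rwa [Real.dist_eq] at this
    have := abs_add_le (z l - p l) (p l)
    rw [sub_add_cancel] at this
    linarith
  calc |t| * (1 + |c| * (|z l| + |t|)) ≤ |t| * M := by rw [hM]; gcongr
    _ < R := (lt_div_iff₀ hM0).1 h2

/-- Commutator loops: tangency to `∂_a + x_b ∂_τ` and `∂_b - x_a ∂_τ` gives local invariance
under translations along `τ`. -/
lemma TangentTo.exists_translate_mem {N : ℕ} {F U : Set (Fin N → ℝ)} (hU : IsOpen U) (hFU : F ⊆ U)
    (hcl : ∀ z r, Metric.closedBall z r ⊆ U → IsClosed (F ∩ Metric.closedBall z r))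
    {a b τ : Fin N} (hab : a ≠ b) (haτ : a ≠ τ) (hbτ : b ≠ τ)
    (hA : TangentTo F (shearField a b τ 1)) (hB : TangentTo F (shearField b a τ (-1)))
    {p : Fin N → ℝ} (hp : p ∈ F) :
    ∀ᶠ t : ℝ in 𝓝 0, p + t • (Pi.single τ 1 : Fin N → ℝ) ∈ F := by
  obtain ⟨R₀, hR₀, hR₀U⟩ := Metric.nhds_basis_closedBall.mem_iff.1 (hU.mem_nhds (hFU hp))
  have hR : 0 < R₀ / 2 := by positivity
  have hclR (z : Fin N → ℝ) (hz : z ∈ Metric.ball p (R₀ / 2)) :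
      IsClosed (F ∩ Metric.closedBall z (R₀ / 2)) :=
    hcl _ _ (subset_trans (Metric.closedBall_subset_closedBall' (by
      have := Metric.mem_ball.1 hz; linarith)) hR₀U)
  obtain ⟨ρ₁, hρ₁, h₁⟩ := hA.exists_uniform_segment hab haτ hbτ p hR hclR
  obtain ⟨ρ₂, hρ₂, h₂⟩ := hB.exists_uniform_segment hab.symm hbτ haτ p hR hclR
  have hev : ∀ᶠ q : ℝ × ℝ in 𝓝 (0, 0), p + (-2 * q.1 * q.2) • (Pi.single τ 1 : Fin N → ℝ) ∈ F := by
    set z₁ : ℝ × ℝ → Fin N → ℝ := fun q => p + q.1 • shearField a b τ 1 p with hz₁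
    set z₂ : ℝ × ℝ → Fin N → ℝ := fun q => z₁ q + q.2 • shearField b a τ (-1) (z₁ q) with hz₂
    set z₃ : ℝ × ℝ → Fin N → ℝ := fun q => z₂ q + (-q.1) • shearField a b τ 1 (z₂ q) with hz₃
    set z₄ : ℝ × ℝ → Fin N → ℝ := fun q => z₃ q + (-q.2) • shearField b a τ (-1) (z₃ q) with hz₄
    have hc (k l : Fin N) (c : ℝ) : Continuous (shearField k l τ c) := by
      unfold shearField; fun_prop
    have c₁ : Continuous z₁ := by fun_prop
    have c₂ : Continuous z₂ := c₁.add (continuous_snd.smul ((hc _ _ _).comp c₁))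
    have c₃ : Continuous z₃ := c₂.add (continuous_fst.neg.smul ((hc _ _ _).comp c₂))
    have c₄ : Continuous z₄ := c₃.add (continuous_snd.neg.smul ((hc _ _ _).comp c₃))
    have near {z : ℝ × ℝ → Fin N → ℝ} (hz : Continuous z) (h0 : z (0, 0) = p) :
        ∀ᶠ q in 𝓝 (0, 0), z q ∈ Metric.ball p (R₀ / 2) :=
      hz.continuousAt.eventually (by rw [h0]; exact Metric.ball_mem_nhds p hR)
    have s₁ : ∀ᶠ q : ℝ × ℝ in 𝓝 (0, 0), |q.1| < ρ₁ :=
      continuous_fst.abs.continuousAt.eventually (gt_mem_nhds (by simpa using hρ₁))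
    have s₂ : ∀ᶠ q : ℝ × ℝ in 𝓝 (0, 0), |q.2| < ρ₂ :=
      continuous_snd.abs.continuousAt.eventually (gt_mem_nhds (by simpa using hρ₂))
    filter_upwards [near c₁ (by simp [hz₁]), near c₂ (by simp [hz₂, hz₁]),
      near c₃ (by simp [hz₃, hz₂, hz₁]), near c₄ (by simp [hz₄, hz₃, hz₂, hz₁]), s₁, s₂]
      with q n₁ n₂ n₃ n₄ t₁ t₂
    have m₁ : z₁ q ∈ F := h₁ _ hp _ t₁ n₁
    have m₂ : z₂ q ∈ F := h₂ _ m₁ _ t₂ n₂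
    have m₃ : z₃ q ∈ F := h₁ _ m₂ _ (by rwa [abs_neg]) n₃
    have m₄ : z₄ q ∈ F := h₂ _ m₃ _ (by rwa [abs_neg]) n₄
    convert m₄ using 1
    ext i
    by_cases hia : i = a
    · subst hia; simp [hz₄, hz₃, hz₂, hz₁, shearField, hab, haτ]
    by_cases hib : i = b
    · subst hib; simp [hz₄, hz₃, hz₂, hz₁, shearField, hab.symm, hbτ]
    by_cases hiτ : i = τ
    · subst hiτ
      simp [hz₄, hz₃, hz₂, hz₁, shearField, hab, hab.symm, haτ, haτ.symm, hbτ, hbτ.symm]; ring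
    · simp [hz₄, hz₃, hz₂, hz₁, shearField, hia, hib, hiτ]
  obtain ⟨δ, hδ, hball⟩ := Metric.eventually_nhds_iff_ball.1 hev
  have hδ2 : 0 < δ / 2 := by positivity
  filter_upwards [Metric.ball_mem_nhds (0 : ℝ) (by positivity : 0 < δ * δ)] with t ht
  have ht : |t| < δ * δ := by simpa [Real.dist_eq] using ht
  have := hball (δ / 2, -(t / δ)) (by
    rw [← ball_prod_same]
    refine ⟨?_, ?_⟩
    · simp only [Metric.mem_ball, Real.dist_eq, sub_zero, abs_of_pos hδ2]; linarith
    · simp only [Metric.mem_ball, Real.dist_eq, sub_zero, abs_neg, abs_div, abs_of_pos hδ]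
      rwa [div_lt_iff₀ hδ])
  convert this using 3
  field_simp

/-- Propagation of the contact set. -/
lemma TangentTo.mem_nhds {N : ℕ} {F U : Set (Fin N → ℝ)} (hU : IsOpen U) (hFU : F ⊆ U)
    (hcl : ∀ z r, Metric.closedBall z r ⊆ U → IsClosed (F ∩ Metric.closedBall z r))
    {a b τ : Fin N} (hab : a ≠ b) (haτ : a ≠ τ) (hbτ : b ≠ τ)
    (hA : TangentTo F (shearField a b τ 1)) (hB : TangentTo F (shearField b a τ (-1)))
    (hX : ∀ k, k ≠ τ → ∃ m : (Fin N → ℝ) → ℝ,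
      TangentTo F (fun x => Pi.single k 1 + m x • Pi.single τ 1))
    {p₀ : Fin N → ℝ} (hp₀ : p₀ ∈ F) : F ∈ 𝓝 p₀ := by
  obtain ⟨R, hR, hRU⟩ := Metric.nhds_basis_closedBall.mem_iff.1 (hU.mem_nhds (hFU hp₀))
  have hg0 : ∀ᶠ y : Fin N → ℝ in 𝓝 p₀, ∑ i, (p₀ i - y i) ^ 2 < (R / 2) ^ 2 := by
    have : Continuous fun y : Fin N → ℝ => ∑ i, (p₀ i - y i) ^ 2 := by fun_prop
    exact this.continuousAt.eventually (gt_mem_nhds (by simp; positivity))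
  filter_upwards [hg0, Metric.ball_mem_nhds p₀ (by positivity : 0 < R / 2)] with y hy hyR
  set g : (Fin N → ℝ) → ℝ := fun x => ∑ i, (x i - y i) ^ 2 with hg
  have hgc : ContDiff ℝ 2 g := by rw [hg]; fun_prop
  obtain ⟨p, hpF, -, hpmin, -⟩ := exists_isLocalMinOn (hcl p₀ R hRU) hgc.continuous hp₀
    (Metric.mem_closedBall_self hR.le) (by
      intro x _ hx
      have hxy : dist x y ≤ R / 2 := by
        refine (dist_pi_le_iff (by positivity)).2 fun i => ?_
        rw [Real.dist_eq]
        have := Finset.single_le_sum (f := fun i => (x i - y i) ^ 2) (fun i _ => sq_nonneg _)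
          (Finset.mem_univ i)
        exact abs_le_of_sq_le_sq (this.trans (hx.trans hy.le)) (by positivity)
      have := dist_triangle x y p₀
      rw [Metric.mem_ball] at hyR ⊢
      linarith)
  have hd (w : Fin N → ℝ) : HasDerivAt (fun s : ℝ => g (p + s • w)) (∑ i, 2 * (p i - y i) * w i) 0 := by
    refine (HasDerivAt.fun_sum (u := Finset.univ) (A := fun i (s : ℝ) => ((p + s • w) i - y i) ^ 2)
      (A' := fun i => 2 * (p i - y i) * w i) fun i _ => ?_)
    refine ((((((hasDerivAt_id (0 : ℝ)).mul_const (w i)).const_add (p i)).sub_const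
      (y i)).pow 2).congr_deriv ?_)
    simp
  have hτ : p τ = y τ := by
    have hmin : IsLocalMin (fun s : ℝ => g (p + s • (Pi.single τ 1 : Fin N → ℝ))) 0 := by
      have hc : Tendsto (fun s : ℝ => p + s • (Pi.single τ 1 : Fin N → ℝ)) (𝓝 0) (𝓝[F] p) := by
        refine tendsto_nhdsWithin_iff.2 ⟨?_,
          TangentTo.exists_translate_mem hU hFU hcl hab haτ hbτ hA hB hpF⟩
        have : Continuous fun s : ℝ => p + s • (Pi.single τ 1 : Fin N → ℝ) := by fun_prop
        simpa using this.tendsto 0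
      have := hc.eventually hpmin
      simpa [IsLocalMin, IsMinFilter] using this
    have := hmin.hasDerivAt_eq_zero (hd _)
    simp [Pi.single_apply] at this
    linarith
  have hpy : p = y := by
    ext k
    by_cases hk : k = τ
    · rw [hk, hτ]
    obtain ⟨m, hm⟩ := hX k hk
    have := hm.eq_zero_of_hasDerivAt hpF hgc hpmin (hd _)
    simp [mul_add, Finset.sum_add_distrib, Pi.single_apply, hτ] at this
    linarith
  rwa [← hpy]

/-- The coordinate `cv` as a continuous linear map. -/
def cvCLM (N k : ℕ) : (Fin N → ℝ) →L[ℝ] ℝ :=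
  if h : k < N then ContinuousLinearMap.proj ⟨k, h⟩ else 0

lemma cvCLM_apply (N k : ℕ) (x : Fin N → ℝ) : cvCLM N k x = cv N k x := by
  unfold cvCLM cv
  split <;> simp

/-- The fields `ê_j`, `ê_{n+1}^w`, `ê_{n+j}` as `FieldData`. -/
def heisenbergFields (n : ℕ) :
    FieldData (Fin (2 * n) → ℝ) (Finset.Icc 2 n ⊕ Unit ⊕ Finset.Icc 2 n) where
  e := Sum.elim (fun j => ee (2 * n) (j - 2))
    (Sum.elim (fun _ => ee (2 * n) (n - 1)) fun j => ee (2 * n) (n + j - 2))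
  T := ee (2 * n) (2 * n - 1)
  lam := Sum.elim (fun j => cvCLM (2 * n) (n + j - 2))
    (Sum.elim (fun _ => 0) fun j => -cvCLM (2 * n) (j - 2))
  c := Sum.elim (fun _ => 0) (Sum.elim (fun _ => -2) fun _ => 0)

lemma heisenbergFields_inl (n : ℕ) (j : Finset.Icc 2 n) (w : (Fin (2 * n) → ℝ) → ℝ)
    (x : Fin (2 * n) → ℝ) : (heisenbergFields n).fld (Sum.inl j) x (w x) = eLow n j x := by
  simp [FieldData.fld, heisenbergFields, eLow, cvCLM_apply]

lemma heisenbergFields_mid (n : ℕ) (j : Unit) (w : (Fin (2 * n) → ℝ) → ℝ)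
    (x : Fin (2 * n) → ℝ) :
    (heisenbergFields n).fld (Sum.inr (Sum.inl j)) x (w x) = eMid n w x := by
  simp [FieldData.fld, heisenbergFields, eMid, sub_eq_add_neg]

lemma heisenbergFields_inr (n : ℕ) (j : Finset.Icc 2 n) (w : (Fin (2 * n) → ℝ) → ℝ)
    (x : Fin (2 * n) → ℝ) :
    (heisenbergFields n).fld (Sum.inr (Sum.inr j)) x (w x) = eHigh n j x := by
  simp [FieldData.fld, heisenbergFields, eHigh, cvCLM_apply, sub_eq_add_neg]

lemma area_heisenbergFields (n : ℕ) (w : (Fin (2 * n) → ℝ) → ℝ) (x : Fin (2 * n) → ℝ) :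
    (heisenbergFields n).area x (w x) (fderiv ℝ w x) = Gq n w x := by
  simp only [FieldData.area, Fintype.sum_sum_type, heisenbergFields_inl, heisenbergFields_mid,
    heisenbergFields_inr, Gq, vApp, Finset.univ_unique, Finset.sum_singleton]
  rw [Finset.sum_coe_sort (Finset.Icc 2 n) fun j => (fderiv ℝ w x (eLow n j x)) ^ 2,
    Finset.sum_coe_sort (Finset.Icc 2 n) fun j => (fderiv ℝ w x (eHigh n j x)) ^ 2]
  ring

lemma curv_heisenbergFields (n : ℕ) (w : (Fin (2 * n) → ℝ) → ℝ) (x : Fin (2 * n) → ℝ) :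
    (heisenbergFields n).curv w x = Hintr n w x := by
  simp only [FieldData.curv, Fintype.sum_sum_type, heisenbergFields_inl, heisenbergFields_mid,
    heisenbergFields_inr, area_heisenbergFields, Hintr, vApp, Finset.univ_unique,
    Finset.sum_singleton]
  rw [Finset.sum_coe_sort (Finset.Icc 2 n) fun j =>
      fderiv ℝ (fun y => fderiv ℝ w y (eLow n j y) / √(Gq n w y)) x (eLow n j x),
    Finset.sum_coe_sort (Finset.Icc 2 n) fun j =>
      fderiv ℝ (fun y => fderiv ℝ w y (eHigh n j y) / √(Gq n w y)) x (eHigh n j x)]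
  ring

lemma ee_eq_single {N k : ℕ} (h : k < N) : ee N k = Pi.single ⟨k, h⟩ 1 := by
  ext i
  simp [ee, Pi.single_apply, Fin.ext_iff]

lemma tangentTo_contactSet {n : ℕ} {U : Set (Fin (2 * n) → ℝ)} (hU : IsOpen U)
    {u v : (Fin (2 * n) → ℝ) → ℝ} (hu : ContDiffOn ℝ 2 u U) (hv : ContDiffOn ℝ 2 v U)
    (huv : ∀ x ∈ U, u x ≤ v x) (hH : ∀ x ∈ U, Hintr n v x ≤ Hintr n u x)
    (i : Finset.Icc 2 n ⊕ Unit ⊕ Finset.Icc 2 n) :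
    TangentTo {x ∈ U | v x = u x} (fun x => (heisenbergFields n).fld i x (u x)) := by
  intro p hp γ hγ hmin
  have hγd := (hγ.differentiable (by norm_num) p).hasFDerivAt
  have hd : HasFDerivAt (fun x => γ p - γ x - ∑ i, (x i - p i) ^ 2) (-fderiv ℝ γ p) p := by
    have h1 : HasFDerivAt (fun x : Fin (2 * n) → ℝ => ∑ i, (x i - p i) ^ 2) _ p :=
      HasFDerivAt.fun_sum (u := Finset.univ) fun i _ =>
        (((ContinuousLinearMap.proj (R := ℝ) (φ := fun _ : Fin (2 * n) => ℝ) i).hasFDerivAt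
          (x := p)).sub_const (p i)).pow 2
    refine ((hγd.const_sub (γ p)).sub h1).congr_fderiv ?_
    ext y; simp
  have := (heisenbergFields n).fderiv_apply_fld_eq_zero (γ := fun x => γ p - γ x - ∑ i, (x i - p i) ^ 2)
    hU hp.1 hu hv huv (by simpa only [curv_heisenbergFields] using hH) hp.2 (by fun_prop) (by simp)
    (by
      filter_upwards [eventually_nhdsWithin_iff.1 hmin, hU.mem_nhds hp.1] with x h1 hxU h2 hne
      have h3 : γ p ≤ γ x := h1 ⟨hxU, h2⟩
      obtain ⟨j, hj⟩ := Function.ne_iff.1 hne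
      have h4 : 0 < ∑ i, (x i - p i) ^ 2 := Finset.sum_pos' (fun i _ => sq_nonneg _)
        ⟨j, Finset.mem_univ j, by have := sub_ne_zero.2 hj; positivity⟩
      linarith) i
  rw [hd.fderiv] at this
  simpa using this

/-- Theorem E: strong maximum principle for intrinsic graphs
in the Heisenberg group `H_n` (`n ≥ 2`) with constant horizontal
(p-)mean curvature. -/
theorem strong_max_principle_intrinsic_graphs
    (n : ℕ) (hn : 2 ≤ n)
    (U : Set (Fin (2 * n) → ℝ)) (hUopen : IsOpen U)
    (p₀ : Fin (2 * n) → ℝ) (hp₀ : p₀ ∈ U)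
    (u v : (Fin (2 * n) → ℝ) → ℝ)
    (hu : ContDiffOn ℝ (⊤ : ℕ∞) u U) (hv : ContDiffOn ℝ (⊤ : ℕ∞) v U)
    (htouch : v p₀ = u p₀)
    -- `v_{η^{n+1}} ≠ 0` and `u_{η^{n+1}} ≠ 0` at `p₀`
    (hvder : pd (2 * n) (n - 1) v p₀ ≠ 0) (huder : pd (2 * n) (n - 1) u p₀ ≠ 0)
    (hge : ∀ x ∈ U, u x ≤ v x)
    (hH : ∀ x ∈ U, Hintr n v x ≤ Hintr n u x)
    (hconst : (∃ c : ℝ, ∀ x ∈ U, Hintr n v x = c) ∨ (∃ c : ℝ, ∀ x ∈ U, Hintr n u x = c)) :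
    ∃ V : Set (Fin (2 * n) → ℝ), IsOpen V ∧ p₀ ∈ V ∧ ∀ x ∈ V, v x = u x := by
  have hu2 : ContDiffOn ℝ 2 u U := hu.of_le (WithTop.coe_le_coe.2 (le_top (a := (2 : ℕ∞))))
  have hv2 : ContDiffOn ℝ 2 v U := hv.of_le (WithTop.coe_le_coe.2 (le_top (a := (2 : ℕ∞))))
  set F : Set (Fin (2 * n) → ℝ) := {x ∈ U | v x = u x}
  have hT := tangentTo_contactSet hUopen hu2 hv2 hge hH
  have hlow (j : Finset.Icc 2 n) : TangentTo F (eLow n j) := by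
    simpa only [heisenbergFields_inl] using hT (Sum.inl j)
  have hmid : TangentTo F (eMid n u) := by
    simpa only [heisenbergFields_mid] using hT (Sum.inr (Sum.inl ()))
  have hhigh (j : Finset.Icc 2 n) : TangentTo F (eHigh n j) := by
    simpa only [heisenbergFields_inr] using hT (Sum.inr (Sum.inr j))
  have hcl : ∀ z r, Metric.closedBall z r ⊆ U → IsClosed (F ∩ Metric.closedBall z r) := by
    intro z r hzr
    have e : F ∩ Metric.closedBall z r
        = Metric.closedBall z r ∩ (fun x => v x - u x) ⁻¹' {0} := by
      ext x
      simp only [Set.mem_inter_iff, Set.mem_preimage, Set.mem_singleton_iff, sub_eq_zero]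
      exact ⟨fun h => ⟨h.2, h.1.2⟩, fun h => ⟨⟨hzr h.1, h.2⟩, h.1⟩⟩
    rw [e]
    exact ((hv.continuousOn.sub hu.continuousOn).mono hzr).preimage_isClosed_of_isClosed
      Metric.isClosed_closedBall isClosed_singleton
  have hτ : 2 * n - 1 < 2 * n := by lia
  have hA : TangentTo F (shearField ⟨0, by lia⟩ ⟨n, by lia⟩ ⟨2 * n - 1, hτ⟩ 1) := by
    convert hlow ⟨2, by simp [hn]⟩ using 1
    funext x
    simp [eLow, shearField, cv, ee_eq_single hτ, ee_eq_single (show 0 < 2 * n by lia),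
      show n < 2 * n by lia]
  have hB : TangentTo F (shearField ⟨n, by lia⟩ ⟨0, by lia⟩ ⟨2 * n - 1, hτ⟩ (-1)) := by
    convert hhigh ⟨2, by simp [hn]⟩ using 1
    funext x
    simp [eHigh, shearField, cv, ee_eq_single hτ, ee_eq_single (show n < 2 * n by lia),
      show 0 < n by lia, sub_eq_add_neg]
  have hmem : F ∈ 𝓝 p₀ := by
    refine TangentTo.mem_nhds hUopen (fun x hx => hx.1) hcl (by simp; lia) (by simp; lia)
      (by simp; lia) hA hB ?_ ⟨hp₀, htouch⟩
    rintro ⟨k, hk⟩ hne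
    have hkτ : k ≠ 2 * n - 1 := by simpa using hne
    rcases lt_trichotomy k (n - 1) with h | h | h
    · refine ⟨fun x => cv (2 * n) (n + (k + 2) - 2) x, ?_⟩
      convert hlow ⟨k + 2, by simp; lia⟩ using 1
      funext x
      simp [eLow, ee_eq_single hτ, ee_eq_single hk]
    · subst h
      refine ⟨fun x => -(2 * u x), ?_⟩
      convert hmid using 1
      funext x
      simp [eMid, ee_eq_single hτ, ee_eq_single hk, sub_eq_add_neg]
    · refine ⟨fun x => -cv (2 * n) (k + 2 - n - 2) x, ?_⟩
      convert hhigh ⟨k + 2 - n, by simp; lia⟩ using 1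
      funext x
      simp [eHigh, ee_eq_single hτ, ee_eq_single hk, sub_eq_add_neg,
        show n + (k + 2 - n) - 2 = k by lia]
  obtain ⟨V, hVF, hVo, hpV⟩ := mem_nhds_iff.1 hmem
  exact ⟨V, hVo, hpV, fun x hx => (hVF hx).2⟩
end
end

section
/- Let m ≥ 3 and let U ⊆ ℝ^m be a domain. Let F⃗ be a C¹ vector field and u, v C² functions on U such that ∇u + F⃗ ≠ 0 and ∇v + F⃗ ≠ 0 everywhere on U (U is nonsingular for both u and v). Suppose H_F(v) ≤ H_F(u) in U, v ≥ u in U, and v = u at some point p₀ ∈ U. Assume there exists on U a C^∞ orthonormal frame N₁^⊥(u),...,N_{m−1}^⊥(u) of the orthogonal complement of N_F(u) in ℝ^m such that the rank of £(N₁^⊥(u),...,N_{m−1}^⊥(u)) is constantly equal to m on U (and the analogous condition holds with u replaced by v). Then v ≡ u in U. -/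
open Set Finset

noncomputable section

/-- `∇u + F`. -/
def gradF (N : ℕ) (F : (Fin N → ℝ) → (Fin N → ℝ)) (u : (Fin N → ℝ) → ℝ)
    (x : Fin N → ℝ) : Fin N → ℝ :=
  fun i => pd N i u x + F x i

/-- The Legendrian (horizontal) normal `N_F(u) = (∇u + F)/|∇u + F|`. -/
def legN (N : ℕ) (F : (Fin N → ℝ) → (Fin N → ℝ)) (u : (Fin N → ℝ) → ℝ)
    (x : Fin N → ℝ) : Fin N → ℝ :=
  fun i => gradF N F u x i / Real.sqrt (∑ k, (gradF N F u x k) ^ 2)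

/-- The horizontal (p-)mean curvature `H_F(u) = div N_F(u)`. -/
def Hmc (N : ℕ) (F : (Fin N → ℝ) → (Fin N → ℝ)) (u : (Fin N → ℝ) → ℝ)
    (x : Fin N → ℝ) : ℝ :=
  ∑ i : Fin N, pd N (i : ℕ) (fun y => legN N F u y i) x

/-- Lie bracket of vector fields. -/
def lieBr {N : ℕ} (X Y : (Fin N → ℝ) → (Fin N → ℝ)) : (Fin N → ℝ) → (Fin N → ℝ) :=
  fun x => fderiv ℝ Y x (X x) - fderiv ℝ X x (Y x)

/-- `£(S)`: the smallest `C^∞`-module of vector fields containing `S`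
and closed under Lie bracket. -/
inductive LieSpan {N : ℕ} (Ω : Set (Fin N → ℝ)) (S : Set ((Fin N → ℝ) → (Fin N → ℝ))) :
    ((Fin N → ℝ) → (Fin N → ℝ)) → Prop
  | base : ∀ X ∈ S, LieSpan Ω S X
  | smul : ∀ (f : (Fin N → ℝ) → ℝ) (X : (Fin N → ℝ) → (Fin N → ℝ)),
      ContDiffOn ℝ (⊤ : ℕ∞) f Ω → LieSpan Ω S X → LieSpan Ω S (fun x => f x • X x)
  | add : ∀ X Y, LieSpan Ω S X → LieSpan Ω S Y → LieSpan Ω S (fun x => X x + Y x)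
  | bracket : ∀ X Y, LieSpan Ω S X → LieSpan Ω S Y → LieSpan Ω S (lieBr X Y)

/-- An orthonormal frame of the orthogonal complement of `N_F(w)` on `U`
whose Lie span has full rank `m` everywhere. -/
def GoodFrame (m : ℕ) (U : Set (Fin m → ℝ)) (F : (Fin m → ℝ) → (Fin m → ℝ))
    (w : (Fin m → ℝ) → ℝ) : Prop :=
  ∃ Nw : Fin (m - 1) → ((Fin m → ℝ) → (Fin m → ℝ)),
    (∀ α, ContDiffOn ℝ (⊤ : ℕ∞) (Nw α) U) ∧
    (∀ x ∈ U, ∀ α β, (∑ i, Nw α x i * Nw β x i) = if α = β then 1 else 0) ∧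
    (∀ x ∈ U, ∀ α, (∑ i, Nw α x i * legN m F w x i) = 0) ∧
    (∀ x ∈ U, Submodule.span ℝ {v | ∃ Z, LieSpan U (Set.range Nw) Z ∧ Z x = v} = ⊤)

/-- `ℓ` is a proximal normal functional to the set `Z` at `z`. -/
def ProxNormal {E : Type*} [NormedAddCommGroup E] [NormedSpace ℝ E] (Z : Set E) (z : E)
    (ℓ : E →L[ℝ] ℝ) : Prop :=
  ∃ σ : ℝ, ∀ᶠ y in nhds z, y ∈ Z → ℓ (y - z) ≤ σ * ‖y - z‖ ^ 2

/-- The vector field `X` is orthogonal to all proximal normals of `Z`. -/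
def ProxTangent {E : Type*} [NormedAddCommGroup E] [NormedSpace ℝ E] (Z : Set E)
    (X : E → E) : Prop :=
  ∀ z ∈ Z, ∀ ℓ : E →L[ℝ] ℝ, ProxNormal Z z ℓ → ℓ (X z) = 0

theorem norm_smul_le_of_abs_le {E : Type*} [NormedAddCommGroup E] [NormedSpace ℝ E] {r k : ℝ}
    (h : |r| ≤ k) (v : E) : ‖r • v‖ ≤ k * ‖v‖ := by
  rw [norm_smul]
  exact mul_le_mul_of_nonneg_right h (norm_nonneg v)

theorem isClosed_inter_of_closure_inter_subset {E : Type*} [TopologicalSpace E] {U Z K : Set E}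
    (hZ : closure Z ∩ U ⊆ Z) (hKU : K ⊆ U) (hK : IsClosed K) : IsClosed (Z ∩ K) := by
  refine isClosed_of_closure_subset fun x hx => ?_
  have hxK : x ∈ K := hK.closure_subset (closure_mono inter_subset_right hx)
  exact ⟨hZ ⟨closure_mono inter_subset_left hx, hKU hxK⟩, hxK⟩

/-- A planar loop `(A, B)` with velocity `(a, b)` enclosing the area `1 / 60`. -/
theorem exists_loop_area : ∃ A B a b C₁ C₂ : ℝ → ℝ,
    (∀ s, HasDerivAt A (a s) s) ∧ (∀ s, HasDerivAt B (b s) s) ∧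
    (∀ s, HasDerivAt C₁ (a s * B s) s) ∧ (∀ s, HasDerivAt C₂ (A s * b s) s) ∧
    (A 0 = 0 ∧ B 0 = 0 ∧ C₁ 0 = 0 ∧ C₂ 0 = 0) ∧
    (A 1 = 0 ∧ B 1 = 0 ∧ C₁ 1 = -(1 / 60) ∧ C₂ 1 = 1 / 60) ∧
    ∀ s ∈ Icc (0 : ℝ) 1, |a s| ≤ 1 ∧ |b s| ≤ 1 ∧ |A s| ≤ 1 ∧ |B s| ≤ 1 ∧
      |C₁ s| ≤ 2 ∧ |C₂ s| ≤ 1 := by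
  refine ⟨fun s => s - s ^ 2, fun s => s ^ 2 - s ^ 3, fun s => 1 - 2 * s,
    fun s => 2 * s - 3 * s ^ 2,
    fun s => (s - s ^ 2) * (s ^ 2 - s ^ 3) - (2 / 3 * s ^ 3 - 5 / 4 * s ^ 4 + 3 / 5 * s ^ 5),
    fun s => 2 / 3 * s ^ 3 - 5 / 4 * s ^ 4 + 3 / 5 * s ^ 5, ?_⟩
  have dA : ∀ s : ℝ, HasDerivAt (fun s : ℝ => s - s ^ 2) (1 - 2 * s) s := fun s =>
    ((hasDerivAt_id' s).fun_sub (hasDerivAt_pow 2 s)).congr_deriv (by push_cast; ring)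
  have dB : ∀ s : ℝ, HasDerivAt (fun s : ℝ => s ^ 2 - s ^ 3) (2 * s - 3 * s ^ 2) s := fun s =>
    ((hasDerivAt_pow 2 s).fun_sub (hasDerivAt_pow 3 s)).congr_deriv (by push_cast; ring)
  have dC : ∀ s : ℝ, HasDerivAt (fun s : ℝ => 2 / 3 * s ^ 3 - 5 / 4 * s ^ 4 + 3 / 5 * s ^ 5)
      ((s - s ^ 2) * (2 * s - 3 * s ^ 2)) s := fun s =>
    ((((hasDerivAt_pow 3 s).const_mul (2 / 3 : ℝ)).fun_sub
      ((hasDerivAt_pow 4 s).const_mul (5 / 4 : ℝ))).fun_add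
      ((hasDerivAt_pow 5 s).const_mul (3 / 5 : ℝ))).congr_deriv (by push_cast; ring)
  refine ⟨dA, dB, fun s => (((dA s).fun_mul (dB s)).fun_sub (dC s)).congr_deriv (by ring), dC,
    by norm_num, by norm_num, ?_⟩
  rintro s ⟨h0, h1⟩
  have h2 : s ^ 2 ≤ s := by nlinarith
  have h3 : s ^ 3 ≤ s ^ 2 := by nlinarith [sq_nonneg s]
  have h4 : s ^ 4 ≤ s ^ 3 := by nlinarith [pow_nonneg h0 3]
  have h5 : s ^ 5 ≤ s ^ 4 := by nlinarith [pow_nonneg h0 4]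
  have h6 := pow_nonneg h0 5
  have hC : |2 / 3 * s ^ 3 - 5 / 4 * s ^ 4 + 3 / 5 * s ^ 5| ≤ 1 := by
    rw [abs_le]; constructor <;> linarith
  have hA : |s - s ^ 2| ≤ 1 := by rw [abs_le]; constructor <;> linarith
  have hB : |s ^ 2 - s ^ 3| ≤ 1 := by rw [abs_le]; constructor <;> linarith
  refine ⟨?_, ?_, hA, hB, ?_, hC⟩
  · rw [abs_le]; constructor <;> linarith
  · rw [abs_le]; constructor <;> nlinarith
  · refine (abs_sub _ _).trans ?_
    rw [abs_mul]
    linarith [mul_le_one₀ hA (abs_nonneg _) hB]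

section Inner

variable {E : Type*} [NormedAddCommGroup E] [InnerProductSpace ℝ E]

theorem exists_nearest_proxNormal {Z : Set E} {x₀ p : E} {R : ℝ} (hx₀ : x₀ ∈ Z)
    (hK : IsCompact (Z ∩ Metric.closedBall x₀ R)) (hp : dist p x₀ < R / 2) :
    ∃ z ∈ Z ∩ Metric.closedBall x₀ R,
      Metric.infDist p (Z ∩ Metric.closedBall x₀ R) = dist p z ∧
      ProxNormal Z z (innerSL ℝ (p - z)) := by
  have hR : 0 < R := by linarith [dist_nonneg (x := p) (y := x₀)]
  have hmem : x₀ ∈ Z ∩ Metric.closedBall x₀ R := ⟨hx₀, Metric.mem_closedBall_self hR.le⟩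
  obtain ⟨z, hz, hd⟩ := hK.exists_infDist_eq_dist ⟨x₀, hmem⟩ p
  refine ⟨z, hz, hd, 1, ?_⟩
  have h1 : dist p z ≤ dist p x₀ := hd ▸ Metric.infDist_le_dist_of_mem hmem
  have h2 : z ∈ Metric.ball x₀ R := by
    have := dist_triangle z p x₀
    rw [Metric.mem_ball]; rw [dist_comm z p] at this; linarith
  filter_upwards [Metric.isOpen_ball.mem_nhds h2] with y hy hyZ
  have h3 : dist p z ≤ dist p y :=
    hd ▸ Metric.infDist_le_dist_of_mem ⟨hyZ, Metric.ball_subset_closedBall hy⟩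
  rw [dist_eq_norm, dist_eq_norm] at h3
  have h4 : ‖p - y‖ ^ 2 = ‖p - z‖ ^ 2 - 2 * inner ℝ (p - z) (y - z) + ‖y - z‖ ^ 2 := by
    rw [← norm_sub_sq_real]; congr 2; abel
  have h5 : ‖p - z‖ ^ 2 ≤ ‖p - y‖ ^ 2 := by gcongr
  have h6 := sq_nonneg ‖y - z‖
  simp only [innerSL_apply_apply]
  linarith

theorem infDist_sq_le_of_approx_integralCurve {Z : Set E} {x₀ : E} {R : ℝ} (hx₀ : x₀ ∈ Z)
    (hK : IsCompact (Z ∩ Metric.closedBall x₀ R)) {W : ℝ → E → E} {L : ℝ} (hL : 0 ≤ L)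
    (hLip : ∀ s ∈ Icc (0 : ℝ) 1, ∀ x ∈ Metric.closedBall x₀ R, ∀ y ∈ Metric.closedBall x₀ R,
      ‖W s x - W s y‖ ≤ L * ‖x - y‖)
    (hW : ∀ s ∈ Icc (0 : ℝ) 1, ProxTangent Z (W s))
    {γ γ' : ℝ → E} (hγ : ∀ s, HasDerivAt γ (γ' s) s) (hγ0 : γ 0 = x₀)
    (hball : ∀ s ∈ Icc (0 : ℝ) 1, dist (γ s) x₀ < R / 2) {ε : ℝ}
    (hε : ∀ s ∈ Icc (0 : ℝ) 1, ‖γ' s - W s (γ s)‖ ≤ ε) :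
    Metric.infDist (γ 1) (Z ∩ Metric.closedBall x₀ R) ^ 2 ≤ ε ^ 2 * Real.exp (2 * L + 1) := by
  set K := Z ∩ Metric.closedBall x₀ R with hKdef
  have hε0 : 0 ≤ ε := (norm_nonneg _).trans (hε 0 (by simp))
  have hR : 0 < R := by
    have := hball 0 (by simp)
    linarith [dist_nonneg (x := γ 0) (y := x₀)]
  have hmem : x₀ ∈ K := ⟨hx₀, Metric.mem_closedBall_self hR.le⟩
  have hcγ : Continuous γ := continuous_iff_continuousAt.2 fun s => (hγ s).continuousAt
  have key := le_gronwallBound_of_liminf_deriv_right_le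
    (f := fun s => Metric.infDist (γ s) K ^ 2)
    (f' := fun s => (2 * L + 1) * Metric.infDist (γ s) K ^ 2 + ε ^ 2)
    (δ := 0) (K := 2 * L + 1) (ε := ε ^ 2) (a := 0) (b := 1)
    (((Metric.continuous_infDist_pt K).comp hcγ).pow 2).continuousOn ?_ ?_ ?_ 1 (by simp)
  · refine key.trans ?_
    rw [gronwallBound_of_K_ne_0 (by positivity)]
    have h1 : 1 ≤ Real.exp ((2 * L + 1) * (1 - 0)) := Real.one_le_exp (by linarith)
    have h2 : ε ^ 2 / (2 * L + 1) ≤ ε ^ 2 := div_le_self (by positivity) (by linarith)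
    have h3 : (2 * L + 1) * (1 - 0) = 2 * L + 1 := by ring
    rw [h3] at h1
    simp only [h3, zero_mul, zero_add]
    calc _ ≤ ε ^ 2 * (Real.exp (2 * L + 1) - 1) := by
            apply mul_le_mul_of_nonneg_right h2; linarith
      _ ≤ _ := by nlinarith [sq_nonneg ε]
  · intro s hs r hr
    have hs' : s ∈ Icc (0 : ℝ) 1 := ⟨hs.1, hs.2.le⟩
    obtain ⟨z, hz, hd, hpn⟩ := exists_nearest_proxNormal hx₀ hK (hball s hs')
    have hder : HasDerivAt (fun τ => ‖γ τ - z‖ ^ 2) (2 * inner ℝ (γ s - z) (γ' s)) s :=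
      ((hγ s).sub_const z).norm_sq
    have hγs : γ s ∈ Metric.closedBall x₀ R := by
      rw [Metric.mem_closedBall]; linarith [hball s hs']
    have hb : 2 * inner ℝ (γ s - z) (γ' s) ≤ (2 * L + 1) * Metric.infDist (γ s) K ^ 2 + ε ^ 2 := by
      have e0 : inner ℝ (γ s - z) (W s z) = 0 := hW s hs' z hz.1 _ hpn
      have e1 : inner ℝ (γ s - z) (γ' s) = inner ℝ (γ s - z) (γ' s - W s (γ s))
          + inner ℝ (γ s - z) (W s (γ s) - W s z) := by
        rw [inner_sub_right (γ s - z), inner_sub_right (γ s - z), e0]; ring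
      have e2 := (real_inner_le_norm (γ s - z) (γ' s - W s (γ s))).trans
        (mul_le_mul_of_nonneg_left (hε s hs') (norm_nonneg _))
      have e3 := (real_inner_le_norm (γ s - z) (W s (γ s) - W s z)).trans
        (mul_le_mul_of_nonneg_left (hLip s hs' _ hγs _ hz.2) (norm_nonneg _))
      rw [hd, dist_eq_norm, e1]
      nlinarith [sq_nonneg (‖γ s - z‖ - ε)]
    have hlim := hder.hasDerivWithinAt (s := Ioi s)
    rw [hasDerivWithinAt_iff_tendsto_slope' (by simp)] at hlim
    have hev := hlim.eventually (gt_mem_nhds (hb.trans_lt hr))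
    refine Filter.Eventually.frequently ?_
    filter_upwards [hev, self_mem_nhdsWithin] with τ hτ hτs
    refine lt_of_le_of_lt ?_ hτ
    rw [slope_def_field, div_eq_inv_mul]
    have hpos : 0 < τ - s := sub_pos.2 hτs
    have hle : Metric.infDist (γ τ) K ≤ ‖γ τ - z‖ := by
      rw [← dist_eq_norm]; exact Metric.infDist_le_dist_of_mem hz
    rw [hd, dist_eq_norm]
    have := Metric.infDist_nonneg (x := γ τ) (s := K)
    gcongr
  · simp [hγ0, Metric.infDist_zero_of_mem hmem]
  · intro s _; exact le_rfl

set_option maxHeartbeats 1000000 in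
/-- The loop `(s - s², s² - s³)` encloses a nonzero area, so following the time-dependent field
with these controls moves a point along the Lie bracket to second order. -/
theorem ProxNormal.apply_bracket_nonpos [ProperSpace E] {U Z : Set E} (hU : IsOpen U)
    (hZU : Z ⊆ U) (hZ : closure Z ∩ U ⊆ Z) {X Y : E → E}
    (hX : ContDiffOn ℝ 1 X U) (hY : ContDiffOn ℝ 1 Y U)
    (hXZ : ProxTangent Z X) (hYZ : ProxTangent Z Y) {x₀ : E} (hx₀ : x₀ ∈ Z)
    {ℓ : E →L[ℝ] ℝ} (hℓ : ProxNormal Z x₀ ℓ) :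
    ℓ (fderiv ℝ Y x₀ (X x₀) - fderiv ℝ X x₀ (Y x₀)) ≤ 0 := by
  have hxU := hU.mem_nhds (hZU hx₀)
  have hXat := hX.contDiffAt hxU
  have hYat := hY.contDiffAt hxU
  obtain ⟨LX, SX, hSX, hLX⟩ := hXat.exists_lipschitzOnWith
  obtain ⟨LY, SY, hSY, hLY⟩ := hYat.exists_lipschitzOnWith
  obtain ⟨R, hR, hRsub⟩ := Metric.nhds_basis_closedBall.mem_iff.1
    (Filter.inter_mem hxU (Filter.inter_mem hSX hSY))
  have hK : IsCompact (Z ∩ Metric.closedBall x₀ R) :=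
    (isCompact_closedBall x₀ R).of_isClosed_subset
      (isClosed_inter_of_closure_inter_subset hZ (fun y hy => (hRsub hy).1)
        Metric.isClosed_closedBall) inter_subset_right
  set X' := fderiv ℝ X x₀ with hX'
  set Y' := fderiv ℝ Y x₀ with hY'
  obtain ⟨σ, hσ⟩ := hℓ
  set N : ℝ := ‖X x₀‖ + ‖Y x₀‖ + ‖X' (X x₀)‖ + ‖X' (Y x₀)‖ + ‖Y' (X x₀)‖ + ‖Y' (Y x₀)‖ with hN
  set P : ℝ := ‖X'‖ + ‖Y'‖ with hP
  set L : ℝ := LX + LY with hL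
  set Q : ℝ := 2 * (3 * N + 2 * P * N) with hQ
  have hN0 : 0 ≤ N := by positivity
  have hP0 : 0 ≤ P := by positivity
  have hL0 : 0 ≤ L := by positivity
  have hQ0 : 0 ≤ Q := by positivity
  set D : ℝ := Real.exp (2 * L + 1) with hD
  have hD0 : 1 ≤ D := Real.one_le_exp (by positivity)
  set V : E := Y' (X x₀) - X' (Y x₀) with hV
  obtain ⟨C, hC0, hC⟩ : ∃ C : ℝ, 0 ≤ C ∧ ∀ c > 0, ∃ T > 0, ∀ t, 0 < t → t < T → ∃ y ∈ Z,
      ‖x₀ + (t ^ 2 / 60) • V - y‖ ≤ C * c * t ^ 2 := by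
    refine ⟨Q * D, by positivity, fun c hc => ?_⟩
    have hXd := (hXat.differentiableAt one_ne_zero).hasFDerivAt.isLittleO.def hc
    have hYd := (hYat.differentiableAt one_ne_zero).hasFDerivAt.isLittleO.def hc
    obtain ⟨r, hr, hrsub⟩ := Metric.nhds_basis_ball.mem_iff.1 (Filter.inter_mem hXd hYd)
    obtain ⟨A, B, a, b, C₁, C₂, dA, dB, dC₁, dC₂, ⟨hA0, hB0, hC₁0, hC₂0⟩,
      ⟨hA1, hB1, hC₁1, hC₂1⟩, hbd⟩ := exists_loop_area
    set η₁ : ℝ → E := fun s => A s • X x₀ + B s • Y x₀ with hη₁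
    set η₂ : ℝ → E := fun s => (A s ^ 2 / 2) • X' (X x₀) + (B s ^ 2 / 2) • Y' (Y x₀)
      + C₁ s • X' (Y x₀) + C₂ s • Y' (X x₀) with hη₂
    have dη₁ : ∀ s, HasDerivAt η₁ (a s • X x₀ + b s • Y x₀) s := fun s =>
      ((dA s).smul_const _).add ((dB s).smul_const _)
    have dη₂ : ∀ s, HasDerivAt η₂ (a s • X' (η₁ s) + b s • Y' (η₁ s)) s := fun s => by
      refine ((((((dA s).fun_pow 2).div_const 2).smul_const (X' (X x₀))).fun_add
        ((((dB s).fun_pow 2).div_const 2).smul_const (Y' (Y x₀)))).fun_add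
        ((dC₁ s).smul_const (X' (Y x₀)))).fun_add ((dC₂ s).smul_const (Y' (X x₀)))
        |>.congr_deriv ?_
      simp only [hη₁, map_add, map_smul]
      module
    have bη₁ : ∀ s ∈ Icc (0 : ℝ) 1, ‖η₁ s‖ ≤ N := fun s hs => by
      obtain ⟨-, -, hAs, hBs, -, -⟩ := hbd s hs
      have e1 := norm_smul_le_of_abs_le hAs (X x₀)
      have e2 := norm_smul_le_of_abs_le hBs (Y x₀)
      refine (norm_add_le _ _).trans ?_
      linarith [norm_nonneg (X' (X x₀)), norm_nonneg (X' (Y x₀)), norm_nonneg (Y' (X x₀)),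
        norm_nonneg (Y' (Y x₀))]
    have bη₂ : ∀ s ∈ Icc (0 : ℝ) 1, ‖η₂ s‖ ≤ 2 * N := fun s hs => by
      obtain ⟨-, -, hAs, hBs, hC₁s, hC₂s⟩ := hbd s hs
      have sq_half : ∀ r : ℝ, |r| ≤ 1 → |r ^ 2 / 2| ≤ 1 := fun r hr => by
        rw [abs_div, abs_pow, abs_two]
        nlinarith [abs_nonneg r]
      have e1 := norm_smul_le_of_abs_le (sq_half _ hAs) (X' (X x₀))
      have e2 := norm_smul_le_of_abs_le (sq_half _ hBs) (Y' (Y x₀))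
      have e3 := norm_smul_le_of_abs_le hC₁s (X' (Y x₀))
      have e4 := norm_smul_le_of_abs_le hC₂s (Y' (X x₀))
      refine (norm_add₄_le).trans ?_
      linarith [norm_nonneg (X' (X x₀)), norm_nonneg (X' (Y x₀)), norm_nonneg (Y' (X x₀)),
        norm_nonneg (Y' (Y x₀)), norm_nonneg (X x₀), norm_nonneg (Y x₀)]
    obtain ⟨T, hT0, hT1, hTc, hTr, hTR⟩ : ∃ T : ℝ, 0 < T ∧ T ≤ 1 ∧ T ≤ c ∧ 3 * N * T < r ∧
        3 * N * T < R / 2 := by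
      have hρ : 0 < min r (R / 2) := lt_min hr (by positivity)
      have hlt : 3 * N * (min r (R / 2) / (3 * N + 1)) < min r (R / 2) := by
        rw [mul_div_assoc', div_lt_iff₀ (by positivity)]
        nlinarith
      have hle : 3 * N * min (min 1 c) (min r (R / 2) / (3 * N + 1)) < min r (R / 2) :=
        (mul_le_mul_of_nonneg_left (min_le_right _ _) (by positivity)).trans_lt hlt
      exact ⟨min (min 1 c) (min r (R / 2) / (3 * N + 1)), by positivity,
        (min_le_left _ _).trans (min_le_left _ _), (min_le_left _ _).trans (min_le_right _ _),
        hle.trans_le (min_le_left _ _), hle.trans_le (min_le_right _ _)⟩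
    refine ⟨T, hT0, fun t ht0 htT => ?_⟩
    set γ : ℝ → E := fun s => x₀ + (t • η₁ s + t ^ 2 • η₂ s) with hγ
    set W : ℝ → E → E := fun s x => (t * a s) • X x + (t * b s) • Y x with hW
    have bδ : ∀ s ∈ Icc (0 : ℝ) 1, ‖γ s - x₀‖ ≤ 3 * N * t := fun s hs => by
      have e1 : ‖t • η₁ s‖ ≤ t * N := by
        rw [norm_smul, Real.norm_of_nonneg ht0.le]
        exact mul_le_mul_of_nonneg_left (bη₁ s hs) ht0.le
      have e2 : ‖t ^ 2 • η₂ s‖ ≤ t ^ 2 * (2 * N) := by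
        rw [norm_smul, Real.norm_of_nonneg (by positivity)]
        exact mul_le_mul_of_nonneg_left (bη₂ s hs) (by positivity)
      have e3 : t ^ 2 ≤ t := by nlinarith
      simp only [hγ, add_sub_cancel_left]
      refine (norm_add_le _ _).trans ?_
      nlinarith
    have h3N : 3 * N * t ≤ 3 * N * T := by gcongr
    have key := infDist_sq_le_of_approx_integralCurve (W := W) (γ := γ) (L := L)
      (γ' := fun s => t • (a s • X x₀ + b s • Y x₀) + t ^ 2 • (a s • X' (η₁ s) + b s • Y' (η₁ s)))
      (ε := Q * c * t ^ 2) hx₀ hK hL0 ?_ ?_ ?_ ?_ ?_ ?_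
    · have hγ1 : γ 1 = x₀ + (t ^ 2 / 60) • V := by
        simp only [hγ, hη₁, hη₂, hA1, hB1, hC₁1, hC₂1, hV]
        module
      have hne : (Z ∩ Metric.closedBall x₀ R).Nonempty :=
        ⟨x₀, hx₀, Metric.mem_closedBall_self hR.le⟩
      obtain ⟨y, hy, hyd⟩ := hK.exists_infDist_eq_dist hne (γ 1)
      refine ⟨y, hy.1, ?_⟩
      rw [← hγ1, ← dist_eq_norm, ← hyd]
      refine abs_le_of_sq_le_sq' (key.trans ?_) (by positivity) |>.2
      have e1 : (Q * D * c * t ^ 2) ^ 2 = (Q * c * t ^ 2) ^ 2 * (D * D) := by ring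
      rw [e1]
      exact mul_le_mul_of_nonneg_left (le_mul_of_one_le_left (by positivity) hD0) (sq_nonneg _)
    · intro s hs x hx y hy
      obtain ⟨has, hbs, -⟩ := hbd s hs
      have abs_mul_le : ∀ r : ℝ, |r| ≤ 1 → |t * r| ≤ 1 := fun r hr => by
        rw [abs_mul, abs_of_pos ht0]
        exact mul_le_one₀ (by linarith) (abs_nonneg _) hr
      have e1 := norm_smul_le_of_abs_le (abs_mul_le _ has) (X x - X y)
      have e2 := norm_smul_le_of_abs_le (abs_mul_le _ hbs) (Y x - Y y)
      have e3 := hLX.norm_sub_le (hRsub hx).2.1 (hRsub hy).2.1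
      have e4 := hLY.norm_sub_le (hRsub hx).2.2 (hRsub hy).2.2
      have e5 : W s x - W s y = (t * a s) • (X x - X y) + (t * b s) • (Y x - Y y) := by
        simp only [hW]; module
      rw [e5, hL, add_mul]
      exact (norm_add_le _ _).trans (by linarith)
    · intro s hs z hz m hm
      simp [hW, hXZ z hz m hm, hYZ z hz m hm]
    · intro s
      exact (((dη₁ s).const_smul t).add ((dη₂ s).const_smul (t ^ 2))).const_add x₀
    · simp [hγ, hη₁, hη₂, hA0, hB0, hC₁0, hC₂0]
    · intro s hs
      rw [dist_eq_norm]
      linarith [bδ s hs]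
    · intro s hs
      obtain ⟨has, hbs, -⟩ := hbd s hs
      have hmem : γ s ∈ Metric.ball x₀ r := by
        rw [Metric.mem_ball, dist_eq_norm]; linarith [bδ s hs]
      have hδ : γ s - x₀ = t • η₁ s + t ^ 2 • η₂ s := by simp [hγ]
      have err : ∀ (f : E → E) (f' : E →L[ℝ] E) (k : ℝ), |k| ≤ 1 → ‖f'‖ ≤ P →
          ‖f (γ s) - f x₀ - f' (γ s - x₀)‖ ≤ c * ‖γ s - x₀‖ →
          ‖(t * k) • (f (γ s) - f x₀ - f' (γ s - x₀) + t ^ 2 • f' (η₂ s))‖ ≤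
            (3 * N + 2 * P * N) * c * t ^ 2 := fun f f' k hk hf' hf => by
        have e1 : ‖f' (η₂ s)‖ ≤ P * (2 * N) :=
          (f'.le_opNorm _).trans (mul_le_mul hf' (bη₂ s hs) (norm_nonneg _) hP0)
        have e2 : ‖t ^ 2 • f' (η₂ s)‖ ≤ (t * c) * (P * (2 * N)) := by
          rw [norm_smul, Real.norm_of_nonneg (by positivity)]
          refine mul_le_mul ?_ e1 (norm_nonneg _) (by positivity)
          rw [sq]
          exact mul_le_mul_of_nonneg_left (by linarith) ht0.le
        have e3 := hf.trans (mul_le_mul_of_nonneg_left (bδ s hs) hc.le)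
        have e4 : |t * k| ≤ t := by
          rw [abs_mul, abs_of_pos ht0]
          exact mul_le_of_le_one_right ht0.le hk
        refine (norm_smul_le_of_abs_le e4 _).trans ?_
        calc _ ≤ t * (c * (3 * N * t) + t * c * (P * (2 * N))) :=
              mul_le_mul_of_nonneg_left ((norm_add_le _ _).trans (add_le_add e3 e2)) ht0.le
          _ = _ := by ring
      have eX := err X X' (a s) has (by linarith [norm_nonneg Y']) (hrsub hmem).1
      have eY := err Y Y' (b s) hbs (by linarith [norm_nonneg X']) (hrsub hmem).2
      have e5 : t • (a s • X x₀ + b s • Y x₀) + t ^ 2 • (a s • X' (η₁ s) + b s • Y' (η₁ s))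
          - W s (γ s) = -((t * a s) • (X (γ s) - X x₀ - X' (γ s - x₀) + t ^ 2 • X' (η₂ s))
            + (t * b s) • (Y (γ s) - Y x₀ - Y' (γ s - x₀) + t ^ 2 • Y' (η₂ s))) := by
        simp only [hδ, hW, map_add, map_smul]
        module
      rw [e5, norm_neg]
      refine (norm_add_le _ _).trans ?_
      rw [hQ]
      linarith
  by_contra! hpos
  set lam : ℝ := ℓ V with hlam
  set c : ℝ := lam / (240 * (‖ℓ‖ * C + 1)) with hc
  have hc0 : 0 < c := by positivity
  have hcl : ‖ℓ‖ * C * c ≤ lam / 240 := by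
    rw [hc, mul_div_assoc', div_le_div_iff₀ (by positivity) (by positivity)]
    nlinarith
  obtain ⟨T, hT, hTy⟩ := hC c hc0
  obtain ⟨r, hr, hrsub⟩ := Metric.nhds_basis_ball.mem_iff.1 hσ
  set M : ℝ := ‖V‖ / 60 + C * c with hM
  have hM0 : 0 ≤ M := by positivity
  have small : ∀ k ρ : ℝ, 0 < ρ → ∀ᶠ t in nhdsWithin (0 : ℝ) (Ioi 0), k * t ^ 2 < ρ :=
    fun k ρ hρ => by
      refine Filter.Eventually.filter_mono nhdsWithin_le_nhds ?_
      have : Filter.Tendsto (fun t : ℝ => k * t ^ 2) (nhds 0) (nhds (k * 0 ^ 2)) :=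
        Continuous.tendsto (by fun_prop) 0
      exact this.eventually (gt_mem_nhds (by simpa using hρ))
  obtain ⟨t, ⟨ht0, htT⟩, htr, htσ⟩ := (Filter.Eventually.and (Ioo_mem_nhdsGT hT) ((small M r hr).and
    (small (|σ| * M ^ 2) (lam / 240) (by positivity)))).exists
  obtain ⟨y, hyZ, hy⟩ := hTy t ht0 htT
  have hyx : ‖y - x₀‖ ≤ M * t ^ 2 := by
    have e1 : y - x₀ = (t ^ 2 / 60) • V - (x₀ + (t ^ 2 / 60) • V - y) := by abel
    rw [e1]
    refine (norm_sub_le _ _).trans ?_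
    rw [norm_smul, Real.norm_of_nonneg (by positivity), hM]
    linarith
  have hball : y ∈ Metric.ball x₀ r := by
    rw [Metric.mem_ball, dist_eq_norm]; linarith
  have e2 : ℓ (y - x₀) ≤ σ * ‖y - x₀‖ ^ 2 := hrsub hball hyZ
  have e3 : σ * ‖y - x₀‖ ^ 2 ≤ |σ| * (M * t ^ 2) ^ 2 := by
    refine (mul_le_mul_of_nonneg_right (le_abs_self σ) (by positivity)).trans ?_
    gcongr
  have e4 : ℓ (y - x₀) = t ^ 2 / 60 * lam - ℓ (x₀ + (t ^ 2 / 60) • V - y) := by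
    simp only [map_sub, map_add, map_smul, smul_eq_mul, hlam]; ring
  have e5 : ℓ (x₀ + (t ^ 2 / 60) • V - y) ≤ ‖ℓ‖ * (C * c * t ^ 2) :=
    (le_abs_self _).trans ((ℓ.le_opNorm _).trans (mul_le_mul_of_nonneg_left hy (norm_nonneg _)))
  have ht2 : 0 < t ^ 2 := by positivity
  have e6 : |σ| * (M * t ^ 2) ^ 2 ≤ lam / 240 * t ^ 2 := by
    have := mul_le_mul_of_nonneg_right htσ.le ht2.le
    linarith
  have e7 : ‖ℓ‖ * (C * c * t ^ 2) ≤ lam / 240 * t ^ 2 := by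
    have := mul_le_mul_of_nonneg_right hcl ht2.le
    linarith
  have e8 : 0 < lam * t ^ 2 := by positivity
  linarith

theorem exists_proxNormal_ne_zero [ProperSpace E] {U Z : Set E} (hU : IsOpen U)
    (hUc : IsPreconnected U) (hZU : Z ⊆ U) (hZ : closure Z ∩ U ⊆ Z) (hne : Z.Nonempty)
    (hUZ : ¬U ⊆ Z) : ∃ z ∈ Z, ∃ ℓ : E →L[ℝ] ℝ, ProxNormal Z z ℓ ∧ ℓ ≠ 0 := by
  obtain ⟨z, hz, hznhds⟩ : ∃ z ∈ Z, Z ∉ nhds z := by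
    by_contra! hopen
    have hZo : IsOpen Z := isOpen_iff_mem_nhds.2 hopen
    exact hUZ (hUc.subset_of_closure_inter_subset hZo
      (by rwa [inter_eq_self_of_subset_right hZU]) hZ)
  obtain ⟨R, hR, hRU⟩ := Metric.nhds_basis_closedBall.mem_iff.1 (hU.mem_nhds (hZU hz))
  obtain ⟨p, hp, hpZ⟩ := not_subset.1
    fun h => hznhds (Filter.mem_of_superset (Metric.ball_mem_nhds z (half_pos hR)) h)
  have hK : IsCompact (Z ∩ Metric.closedBall z R) :=
    (isCompact_closedBall z R).of_isClosed_subset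
      (isClosed_inter_of_closure_inter_subset hZ hRU Metric.isClosed_closedBall) inter_subset_right
  obtain ⟨y, hy, -, hyn⟩ := exists_nearest_proxNormal hz hK hp
  refine ⟨y, hy.1, _, hyn, fun h0 => ?_⟩
  have h1 : inner ℝ (p - y) (p - y) = (0 : ℝ) := by
    rw [← innerSL_apply_apply (𝕜 := ℝ), h0]; rfl
  rw [inner_self_eq_zero, sub_eq_zero] at h1
  exact hpZ (h1 ▸ hy.1)

end Inner

section Transfer

variable {E E' : Type*} [NormedAddCommGroup E] [NormedSpace ℝ E]

theorem ProxNormal.comp_symm [NormedAddCommGroup E'] [NormedSpace ℝ E'] (e : E ≃L[ℝ] E')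
    {Z : Set E} {z : E} {ℓ : E →L[ℝ] ℝ} (h : ProxNormal Z z ℓ) :
    ProxNormal (e.symm ⁻¹' Z) (e z) (ℓ.comp (e.symm : E' →L[ℝ] E)) := by
  obtain ⟨σ, hσ⟩ := h
  refine ⟨|σ| * ‖(e.symm : E' →L[ℝ] E)‖ ^ 2, ?_⟩
  have ht : Filter.Tendsto e.symm (nhds (e z)) (nhds z) := by
    simpa using e.symm.continuous.tendsto (e z)
  filter_upwards [ht.eventually hσ] with y hy hyZ
  have h1 : e.symm y - z = e.symm (y - e z) := by simp
  have h2 := hy hyZ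
  rw [h1] at h2
  have h3 : ‖e.symm (y - e z)‖ ≤ ‖(e.symm : E' →L[ℝ] E)‖ * ‖y - e z‖ :=
    (e.symm : E' →L[ℝ] E).le_opNorm _
  calc _ ≤ σ * ‖e.symm (y - e z)‖ ^ 2 := h2
    _ ≤ |σ| * (‖(e.symm : E' →L[ℝ] E)‖ * ‖y - e z‖) ^ 2 := by
      gcongr
      exact le_abs_self σ
    _ = _ := by ring

theorem closure_preimage_inter_subset [NormedAddCommGroup E'] [NormedSpace ℝ E']
    (e : E ≃L[ℝ] E') {U Z : Set E} (hZ : closure Z ∩ U ⊆ Z) :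
    closure (e.symm ⁻¹' Z) ∩ e.symm ⁻¹' U ⊆ e.symm ⁻¹' Z := by
  rw [← ContinuousLinearEquiv.coe_toHomeomorph, ← Homeomorph.preimage_closure]
  exact fun x hx => hZ hx

theorem ProxTangent.comp_symm [NormedAddCommGroup E'] [NormedSpace ℝ E'] (e : E ≃L[ℝ] E')
    {Z : Set E} {X : E → E} (h : ProxTangent Z X) :
    ProxTangent (e.symm ⁻¹' Z) (fun y => e (X (e.symm y))) := by
  intro z hz ℓ hℓ
  have h1 := hℓ.comp_symm e.symm
  have h2 : e.symm.symm ⁻¹' (e.symm ⁻¹' Z) = Z := by ext x; simp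
  rw [h2] at h1
  exact h _ hz _ h1

variable [NormedAddCommGroup E'] [InnerProductSpace ℝ E'] [ProperSpace E']

theorem ProxTangent.bracket (e : E ≃L[ℝ] E') {U Z : Set E} (hU : IsOpen U)
    (hZU : Z ⊆ U) (hZ : closure Z ∩ U ⊆ Z) {X Y : E → E}
    (hX : ContDiffOn ℝ 1 X U) (hY : ContDiffOn ℝ 1 Y U)
    (hXZ : ProxTangent Z X) (hYZ : ProxTangent Z Y) :
    ProxTangent Z (fun x => fderiv ℝ Y x (X x) - fderiv ℝ X x (Y x)) := by
  have key : ∀ X Y : E → E, ContDiffOn ℝ 1 X U → ContDiffOn ℝ 1 Y U → ProxTangent Z X →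
      ProxTangent Z Y → ∀ z ∈ Z, ∀ ℓ : E →L[ℝ] ℝ, ProxNormal Z z ℓ →
        ℓ (fderiv ℝ Y z (X z) - fderiv ℝ X z (Y z)) ≤ 0 := by
    intro X Y hX hY hXZ hYZ z hz ℓ hℓ
    have hc : ∀ f : E → E, ContDiffOn ℝ 1 f U →
        ContDiffOn ℝ 1 (fun y => e (f (e.symm y))) (e.symm ⁻¹' U) := fun f hf =>
      e.contDiff.comp_contDiffOn (hf.comp e.symm.contDiff.contDiffOn fun _ hy => hy)
    have hd : ∀ f : E → E, ContDiffOn ℝ 1 f U → ∀ a, fderiv ℝ (fun y => e (f (e.symm y))) (e z) a =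
        e (fderiv ℝ f z (e.symm a)) := fun f hf a => by
      have h1 : HasFDerivAt f (fderiv ℝ f z) (e.symm (e z)) := by
        rw [e.symm_apply_apply]
        exact ((hf.contDiffAt (hU.mem_nhds (hZU hz))).differentiableAt one_ne_zero).hasFDerivAt
      have h2 : HasFDerivAt (fun y => e (f (e.symm y))) _ (e z) :=
        e.hasFDerivAt.comp (e z) (h1.comp (e z) e.symm.hasFDerivAt)
      rw [h2.fderiv]
      rfl
    have := ProxNormal.apply_bracket_nonpos (hU.preimage e.symm.continuous)
      (preimage_mono hZU) (closure_preimage_inter_subset e hZ) (hc X hX) (hc Y hY)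
      (hXZ.comp_symm e) (hYZ.comp_symm e) (x₀ := e z) (by simpa using hz) (hℓ.comp_symm e)
    rw [hd X hX, hd Y hY] at this
    simpa using this
  intro z hz ℓ hℓ
  refine le_antisymm (key X Y hX hY hXZ hYZ z hz ℓ hℓ) ?_
  have := key Y X hY hX hYZ hXZ z hz ℓ hℓ
  rw [← neg_sub, map_neg] at this
  linarith

theorem exists_proxNormal_ne_zero_of_equiv (e : E ≃L[ℝ] E') {U Z : Set E} (hU : IsOpen U)
    (hUc : IsPreconnected U) (hZU : Z ⊆ U) (hZ : closure Z ∩ U ⊆ Z) (hne : Z.Nonempty)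
    (hUZ : ¬U ⊆ Z) : ∃ z ∈ Z, ∃ ℓ : E →L[ℝ] ℝ, ProxNormal Z z ℓ ∧ ℓ ≠ 0 := by
  have himg : e '' U = e.symm ⁻¹' U := e.toEquiv.image_eq_preimage_symm U
  obtain ⟨z, hz, ℓ, hℓ, hℓ0⟩ := exists_proxNormal_ne_zero (hU.preimage e.symm.continuous)
    (himg ▸ hUc.image e e.continuous.continuousOn) (preimage_mono hZU)
    (closure_preimage_inter_subset e hZ) (hne.preimage e.symm.surjective)
    (fun h => hUZ fun x hx => by simpa using h (by simpa using hx : e x ∈ e.symm ⁻¹' U))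
  have h1 := hℓ.comp_symm e.symm
  have h2 : e.symm.symm ⁻¹' (e.symm ⁻¹' Z) = Z := by ext x; simp
  rw [h2] at h1
  refine ⟨_, hz, _, h1, fun h => hℓ0 ?_⟩
  ext x
  simpa using congrArg (fun L : E →L[ℝ] ℝ => L (e.symm x)) h

end Transfer

/-- A multiple of the barrier `h` touches `w` from below arbitrarily close to `z`. -/
theorem exists_isLocalMin_sub_barrier {E : Type*} [NormedAddCommGroup E]
    [ProperSpace E] {w h : E → ℝ} {z : E} {S : Set E}
    (hS : S ∈ nhds z) (hw : ContinuousOn w S) (hh : ContinuousOn h S)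
    (hwn : ∀ y ∈ S, 0 ≤ w y) (hwz : w z = 0) (hhz : h z = 0)
    (hpos : ∀ y ∈ S, y ≠ z → 0 ≤ h y → 0 < w y) :
    ∃ y ∈ S, ∃ ε > 0, IsLocalMin (fun x => w x - ε * h x) y := by
  obtain ⟨ρ, hρ, hρS⟩ := Metric.nhds_basis_closedBall.mem_iff.1 hS
  have hsph : Metric.sphere z ρ ⊆ S := Metric.sphere_subset_closedBall.trans hρS
  have hcomp : IsCompact (Metric.sphere z ρ ∩ h ⁻¹' Ici 0) :=
    (isCompact_sphere z ρ).of_isClosed_subset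
      ((hh.mono hsph).preimage_isClosed_of_isClosed Metric.isClosed_sphere isClosed_Ici)
      inter_subset_left
  obtain ⟨ε, hε, hεpos⟩ : ∃ ε > 0, ∀ y ∈ Metric.sphere z ρ, 0 < w y - ε * h y := by
    have hout : ∀ ε > 0, ∀ y ∈ Metric.sphere z ρ, h y < 0 → 0 < w y - ε * h y :=
      fun ε hε y hy hy0 => by nlinarith [hwn y (hsph hy)]
    rcases (Metric.sphere z ρ ∩ h ⁻¹' Ici 0).eq_empty_or_nonempty with hemp | hne
    · refine ⟨1, one_pos, fun y hy => hout 1 one_pos y hy ?_⟩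
      by_contra! hy0
      exact (hemp ▸ (⟨hy, hy0⟩ : y ∈ Metric.sphere z ρ ∩ h ⁻¹' Ici 0) : y ∈ (∅ : Set E))
    · have hsub : Metric.sphere z ρ ∩ h ⁻¹' Ici 0 ⊆ S := inter_subset_left.trans hsph
      obtain ⟨y₁, hy₁, hmin⟩ := hcomp.exists_isMinOn hne (hw.mono hsub)
      obtain ⟨y₂, hy₂, hmax⟩ := hcomp.exists_isMaxOn hne (hh.mono hsub)
      have hy₁z : y₁ ≠ z := Metric.ne_of_mem_sphere hy₁.1 hρ.ne'
      have hw₁ : 0 < w y₁ := hpos y₁ (hsub hy₁) hy₁z hy₁.2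
      have hh₂ : 0 ≤ h y₂ := hy₂.2
      refine ⟨w y₁ / (h y₂ + 1), by positivity, fun y hy => ?_⟩
      rcases lt_or_ge (h y) 0 with hy0 | hy0
      · exact hout _ (by positivity) y hy hy0
      · have e1 : w y₁ ≤ w y := hmin ⟨hy, hy0⟩
        have e2 : h y ≤ h y₂ := hmax ⟨hy, hy0⟩
        have e3 : w y₁ / (h y₂ + 1) * h y < w y₁ := by
          rw [div_mul_eq_mul_div, div_lt_iff₀ (by positivity)]
          nlinarith
        linarith
  obtain ⟨y, hy, hmin⟩ := (isCompact_closedBall z ρ).exists_isMinOn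
    ⟨z, Metric.mem_closedBall_self hρ.le⟩
    ((hw.mono hρS).sub ((hh.mono hρS).const_mul ε) : ContinuousOn (fun x => w x - ε * h x) _)
  have hyz : w y - ε * h y ≤ w z - ε * h z := hmin (Metric.mem_closedBall_self hρ.le)
  rw [hwz, hhz, mul_zero, sub_zero] at hyz
  have hyb : y ∈ Metric.ball z ρ := by
    rcases (Metric.mem_closedBall.1 hy).lt_or_eq with h1 | h1
    · exact h1
    · exact absurd (hεpos y h1) hyz.not_gt
  exact ⟨y, hρS hy, ε, hε, hmin.isLocalMin
    (Filter.mem_of_superset (Metric.isOpen_ball.mem_nhds hyb) Metric.ball_subset_closedBall)⟩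

section Normed

variable {E : Type*} [NormedAddCommGroup E] [NormedSpace ℝ E]

theorem IsLocalMin.fderiv_fderiv_apply_self_nonneg {φ : E → ℝ} {y : E} (hφ : ContDiffAt ℝ 2 φ y)
    (hmin : IsLocalMin φ y) (n : E) : 0 ≤ fderiv ℝ (fderiv ℝ φ) y n n := by
  by_contra! hneg
  have hd : ∀ᶠ x in nhds y, DifferentiableAt ℝ φ x := by
    filter_upwards [hφ.eventually (by simp)] with x hx
    exact hx.differentiableAt two_ne_zero
  have hd2 : DifferentiableAt ℝ (fderiv ℝ φ) y :=
    (hφ.fderiv_right (m := 1) (by norm_num)).differentiableAt one_ne_zero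
  have hline : ∀ t : ℝ, HasDerivAt (fun t : ℝ => y + t • n) n t := fun t => by
    simpa using ((hasDerivAt_id' t).smul_const n).const_add y
  have hcont : Filter.Tendsto (fun t : ℝ => y + t • n) (nhds 0) (nhds y) := by
    have : Continuous (fun t : ℝ => y + t • n) := by fun_prop
    simpa using this.tendsto 0
  have h1 : ∀ᶠ t in nhds (0 : ℝ),
      HasDerivAt (fun t : ℝ => φ (y + t • n)) (fderiv ℝ φ (y + t • n) n) t := by
    filter_upwards [hcont.eventually hd] with t ht
    exact ht.hasFDerivAt.comp_hasDerivAt t (hline t)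
  have h2 : HasDerivAt (fun t : ℝ => fderiv ℝ φ (y + t • n) n) (fderiv ℝ (fderiv ℝ φ) y n n) 0 := by
    have h3 : HasFDerivAt (fderiv ℝ φ) (fderiv ℝ (fderiv ℝ φ) y) (y + (0 : ℝ) • n) := by
      simpa using hd2.hasFDerivAt
    have h4 : HasDerivAt (fun t : ℝ => fderiv ℝ φ (y + t • n)) (fderiv ℝ (fderiv ℝ φ) y n) 0 :=
      h3.comp_hasDerivAt (0 : ℝ) (hline 0)
    exact ((ContinuousLinearMap.apply ℝ ℝ n).hasFDerivAt.comp_hasDerivAt (0 : ℝ) h4 :)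
  have h0 : fderiv ℝ φ y n = 0 := by simp [hmin.fderiv_eq_zero]
  rw [hasDerivAt_iff_tendsto_slope_zero] at h2
  have h4 := h2.eventually (gt_mem_nhds hneg)
  have h5 : ∀ᶠ t in nhds (0 : ℝ), φ y ≤ φ (y + t • n) := hcont.eventually hmin
  rw [eventually_nhdsWithin_iff] at h4
  obtain ⟨r, hr, hball⟩ := Metric.eventually_nhds_iff_ball.1 (h1.and (h4.and h5))
  have hin : ∀ t ∈ Icc (0 : ℝ) (r / 2), t ∈ Metric.ball (0 : ℝ) r := fun t ht => by
    rw [Metric.mem_ball, Real.dist_0_eq_abs, abs_of_nonneg ht.1]; linarith [ht.2]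
  have hanti : StrictAntiOn (fun t : ℝ => φ (y + t • n)) (Icc 0 (r / 2)) := by
    refine strictAntiOn_of_deriv_neg (convex_Icc _ _)
      (fun t ht => (hball t (hin t ht)).1.continuousAt.continuousWithinAt) fun t ht => ?_
    rw [interior_Icc] at ht
    have hb := hball t (hin t ⟨ht.1.le, ht.2.le⟩)
    rw [hb.1.deriv]
    have := hb.2.1 (by simpa using ht.1.ne')
    simp only [zero_add, zero_smul, add_zero, h0, sub_zero, smul_eq_mul] at this
    have h6 := mul_neg_of_pos_of_neg ht.1 this
    rwa [← mul_assoc, mul_inv_cancel₀ ht.1.ne', one_mul] at h6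
  have h7 := hanti (left_mem_Icc.2 (by positivity)) (right_mem_Icc.2 (by positivity))
    (half_pos hr)
  have h8 := (hball (r / 2) (hin _ (right_mem_Icc.2 (by positivity)))).2.2
  simp only [zero_smul, add_zero] at h7
  linarith

/-- Comparison of a barrier with a nonnegative supersolution of a degenerate elliptic inequality
at a zero of the supersolution. -/
theorem barrier_le_of_touching [ProperSpace E] {ι : Type*} [Fintype ι] {w h : E → ℝ} {z : E}
    (hw : ContDiffAt ℝ 2 w z) (hh : ContDiffAt ℝ 2 h z)
    (hwn : ∀ᶠ y in nhds z, 0 ≤ w y) (hwz : w z = 0) (hhz : h z = 0)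
    (hpos : ∀ᶠ y in nhds z, y ≠ z → 0 ≤ h y → 0 < w y)
    {n : ι → E → E} (hn : ∀ α, ContinuousAt (n α) z) {C : ℝ}
    (hL : ∀ᶠ y in nhds z, ∑ α, fderiv ℝ (fderiv ℝ w) y (n α y) (n α y) ≤ C * ‖fderiv ℝ w y‖) :
    ∑ α, fderiv ℝ (fderiv ℝ h) z (n α z) (n α z) ≤ C * ‖fderiv ℝ h z‖ := by
  by_contra! hlt
  have hh1 : ContinuousAt (fderiv ℝ h) z :=
    (hh.fderiv_right (m := 1) (by norm_num)).continuousAt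
  have hh2 : ContinuousAt (fderiv ℝ (fderiv ℝ h)) z :=
    ((hh.fderiv_right (m := 1) (by norm_num)).fderiv_right (m := 0) (by norm_num)).continuousAt
  have hev : ∀ᶠ y in nhds z,
      C * ‖fderiv ℝ h y‖ < ∑ α, fderiv ℝ (fderiv ℝ h) y (n α y) (n α y) := by
    refine ContinuousAt.eventually_lt (continuousAt_const.mul hh1.norm) ?_ hlt
    exact tendsto_finsetSum _ fun α _ => (hh2.clm_apply (hn α)).clm_apply (hn α)
  obtain ⟨y, hyS, ε, hε, hmin⟩ := exists_isLocalMin_sub_barrier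
    (S := {y | ContDiffAt ℝ 2 w y ∧ ContDiffAt ℝ 2 h y ∧ 0 ≤ w y ∧
      (y ≠ z → 0 ≤ h y → 0 < w y) ∧
      (∑ α, fderiv ℝ (fderiv ℝ w) y (n α y) (n α y) ≤ C * ‖fderiv ℝ w y‖) ∧
      C * ‖fderiv ℝ h y‖ < ∑ α, fderiv ℝ (fderiv ℝ h) y (n α y) (n α y)})
    ((hw.eventually (by simp)).and ((hh.eventually (by simp)).and
      (hwn.and (hpos.and (hL.and hev)))))
    (fun y hy => hy.1.continuousAt.continuousWithinAt)
    (fun y hy => hy.2.1.continuousAt.continuousWithinAt)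
    (fun y hy => hy.2.2.1) hwz hhz (fun y hy => hy.2.2.2.1)
  obtain ⟨hwy, hhy, -, -, hLy, hBy⟩ := hyS
  have hd : ∀ x, ContDiffAt ℝ 2 w x → ContDiffAt ℝ 2 h x →
      fderiv ℝ (fun x => w x - ε * h x) x = fderiv ℝ w x - ε • fderiv ℝ h x := fun x h1 h2 => by
    rw [fderiv_fun_sub (h1.differentiableAt two_ne_zero)
      ((h2.differentiableAt two_ne_zero).const_mul ε),
      fderiv_const_mul (h2.differentiableAt two_ne_zero)]
  have hdd : fderiv ℝ (fderiv ℝ (fun x => w x - ε * h x)) y =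
      fderiv ℝ (fderiv ℝ w) y - ε • fderiv ℝ (fderiv ℝ h) y := by
    have hev : fderiv ℝ (fun x => w x - ε * h x) =ᶠ[nhds y]
        fun x => fderiv ℝ w x - ε • fderiv ℝ h x := by
      filter_upwards [hwy.eventually (by simp), hhy.eventually (by simp)] with x h1 h2
      exact hd x h1 h2
    have e1 : DifferentiableAt ℝ (fderiv ℝ w) y :=
      (hwy.fderiv_right (m := 1) (by norm_num)).differentiableAt one_ne_zero
    have e2 : DifferentiableAt ℝ (fderiv ℝ h) y :=
      (hhy.fderiv_right (m := 1) (by norm_num)).differentiableAt one_ne_zero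
    rw [hev.fderiv_eq]
    exact (e1.hasFDerivAt.fun_sub (e2.hasFDerivAt.fun_const_smul ε)).fderiv
  have h1 : fderiv ℝ w y = ε • fderiv ℝ h y := by
    have := hmin.fderiv_eq_zero
    rw [hd y hwy hhy] at this
    exact sub_eq_zero.1 this
  have h2 : ∀ α, ε * fderiv ℝ (fderiv ℝ h) y (n α y) (n α y) ≤
      fderiv ℝ (fderiv ℝ w) y (n α y) (n α y) := fun α => by
    have := hmin.fderiv_fderiv_apply_self_nonneg (hwy.sub (contDiffAt_const.mul hhy)) (n α y)
    rw [hdd] at this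
    simpa using this
  have h3 := (Finset.sum_le_sum fun α (_ : α ∈ Finset.univ) => h2 α).trans hLy
  rw [← Finset.mul_sum, h1, norm_smul, Real.norm_of_nonneg hε.le] at h3
  have h4 := mul_lt_mul_of_pos_left hBy hε
  linarith

/-- The Hopf lemma for degenerate elliptic inequalities: the directions of ellipticity are
orthogonal to the proximal normals of the zero set. -/
theorem ProxNormal.apply_eq_zero_of_supersolution [ProperSpace E] {ι : Type*} [Fintype ι]
    {q : E → ℝ} (hq : ContDiff ℝ 2 q) (hq0 : q 0 = 0) (hqn : ∀ x, ‖x‖ ^ 2 ≤ q x)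
    {w : E → ℝ} {Z : Set E} {z : E}
    (hw : ContDiffAt ℝ 2 w z) (hwn : ∀ᶠ y in nhds z, 0 ≤ w y) (hwz : w z = 0)
    (hZ : ∀ᶠ y in nhds z, w y = 0 → y ∈ Z)
    {n : ι → E → E} (hn : ∀ α, ContinuousAt (n α) z) {C : ℝ}
    (hL : ∀ᶠ y in nhds z, ∑ α, fderiv ℝ (fderiv ℝ w) y (n α y) (n α y) ≤ C * ‖fderiv ℝ w y‖)
    {ℓ : E →L[ℝ] ℝ} (hℓ : ProxNormal Z z ℓ) (α : ι) : ℓ (n α z) = 0 := by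
  obtain ⟨σ, hσ⟩ := hℓ
  set g : E → ℝ := fun y => ℓ (y - z) - (|σ| + 1) * q (y - z) with hg
  have hgc : ContDiff ℝ 2 g :=
    (ℓ.contDiff.comp (contDiff_id.sub contDiff_const)).sub
      (contDiff_const.mul (hq.comp (contDiff_id.sub contDiff_const)))
  have hgz : g z = 0 := by simp [hg, hq0]
  have hgneg : ∀ᶠ y in nhds z, y ≠ z → y ∈ Z → g y < 0 := by
    filter_upwards [hσ] with y hy hyz hyZ
    have h1 : 0 < ‖y - z‖ ^ 2 := by
      have := norm_pos_iff.2 (sub_ne_zero.2 hyz); positivity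
    have h2 := hqn (y - z)
    have h3 := hy hyZ
    have h4 : σ * ‖y - z‖ ^ 2 ≤ |σ| * ‖y - z‖ ^ 2 :=
      mul_le_mul_of_nonneg_right (le_abs_self σ) h1.le
    have h5 := mul_le_mul_of_nonneg_left h2 (abs_nonneg σ)
    simp only [hg]
    linarith
  have hgd : ∀ y, HasFDerivAt g (fderiv ℝ g y) y := fun y =>
    (hgc.differentiable two_ne_zero y).hasFDerivAt
  have hgdd : HasFDerivAt (fderiv ℝ g) (fderiv ℝ (fderiv ℝ g) z) z :=
    ((hgc.fderiv_right (m := 1) (by norm_num)).differentiable one_ne_zero z).hasFDerivAt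
  have hgℓ : fderiv ℝ g z = ℓ := by
    have h1 : HasFDerivAt q (0 : E →L[ℝ] ℝ) (z - z) := by
      have hmin : IsLocalMin q 0 := Filter.Eventually.of_forall fun x => by
        rw [hq0]; exact (sq_nonneg _).trans (hqn x)
      rw [sub_self, ← hmin.fderiv_eq_zero]
      exact (hq.differentiable two_ne_zero 0).hasFDerivAt
    have h2 : HasFDerivAt (fun y : E => y - z) (ContinuousLinearMap.id ℝ E) z :=
      (hasFDerivAt_id z).sub_const z
    have h3 := (HasFDerivAt.comp (f := fun y : E => y - z) z ℓ.hasFDerivAt h2).sub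
      ((HasFDerivAt.comp (f := fun y : E => y - z) z h1 h2).const_mul (|σ| + 1))
    refine (HasFDerivAt.congr_fderiv h3 ?_ : HasFDerivAt g ℓ z).fderiv
    ext x; simp
  have key : ∀ K : ℝ, ∑ β, fderiv ℝ (fderiv ℝ g) z (n β z) (n β z)
      + K * ∑ β, ℓ (n β z) ^ 2 ≤ C * ‖ℓ‖ := fun K => by
    set h : E → ℝ := fun y => g y + K / 2 * g y ^ 2 with hh
    have hhc : ContDiff ℝ 2 h := hgc.add (contDiff_const.mul (hgc.pow 2))
    have hd : fderiv ℝ h = fun y => (1 + K * g y) • fderiv ℝ g y := by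
      funext y
      have := (hgd y).add (((hgd y).pow 2).const_mul (K / 2))
      refine (this.congr_fderiv ?_ : HasFDerivAt h _ y).fderiv
      ext x; simp; ring
    have hdd : ∀ x, fderiv ℝ (fderiv ℝ h) z x x =
        fderiv ℝ (fderiv ℝ g) z x x + K * ℓ x ^ 2 := fun x => by
      rw [hd]
      have := (((hgd z).const_mul K).const_add 1).fun_smul hgdd
      rw [HasFDerivAt.fderiv this]
      simp [hgz, hgℓ]; ring
    have := barrier_le_of_touching hw hhc.contDiffAt hwn hwz (by simp [hh, hgz]) ?_ hn hL
    · simp only [hdd, Finset.sum_add_distrib, ← Finset.mul_sum] at this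
      simpa [hd, hgz, hgℓ] using this
    · have hsmall : ∀ᶠ y in nhds z, 0 < 1 + K / 2 * g y := by
        have : ContinuousAt (fun y => 1 + K / 2 * g y) z := by
          have := hgc.continuous; fun_prop
        exact this.eventually (lt_mem_nhds (by simp [hgz]))
      filter_upwards [hsmall, hgneg, hwn, hZ] with y h1 h2 h3 h4 hyz hhy
      refine lt_of_le_of_ne h3 fun h5 => ?_
      have h6 := h2 hyz (h4 h5.symm)
      have h7 : h y = g y * (1 + K / 2 * g y) := by simp only [hh]; ring
      have h8 := mul_neg_of_neg_of_pos h6 h1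
      linarith
  by_contra hne
  have hs : 0 < ∑ β, ℓ (n β z) ^ 2 :=
    Finset.sum_pos' (fun β _ => sq_nonneg _) ⟨α, Finset.mem_univ α, by positivity⟩
  set D := ∑ β, fderiv ℝ (fderiv ℝ g) z (n β z) (n β z)
  have := key ((C * ‖ℓ‖ - D + 1) / ∑ β, ℓ (n β z) ^ 2)
  rw [div_mul_cancel₀ _ hs.ne'] at this
  linarith

end Normed

theorem ee_eq_single_s5 {m : ℕ} (i : Fin m) : ee m i = Pi.single i 1 := by
  funext j
  simp [ee, Pi.single_apply, Fin.ext_iff]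

theorem norm_ee_le {m : ℕ} (i : Fin m) : ‖ee m i‖ ≤ 1 := by
  rw [ee_eq_single_s5, Pi.norm_single, norm_one]

theorem sum_smul_ee {m : ℕ} (a : Fin m → ℝ) : ∑ i : Fin m, a i • ee m i = a := by
  simp_rw [ee_eq_single_s5]
  exact (pi_eq_sum_univ' a).symm

/-- The Euclidean normalization `p ↦ p / |p|`. -/
def unitVec (m : ℕ) (p : Fin m → ℝ) : Fin m → ℝ :=
  fun i => p i / Real.sqrt (∑ k, p k ^ 2)

theorem sum_sq_pos_of_ne_zero {m : ℕ} {p : Fin m → ℝ} (hp : p ≠ 0) : 0 < ∑ k, p k ^ 2 := by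
  obtain ⟨i, hi⟩ := Function.ne_iff.1 hp
  exact Finset.sum_pos' (fun k _ => sq_nonneg _)
    ⟨i, Finset.mem_univ i, by have : p i ≠ 0 := hi; positivity⟩

theorem contDiffAt_unitVec {m : ℕ} {p : Fin m → ℝ} (hp : p ≠ 0) :
    ContDiffAt ℝ 2 (unitVec m) p := by
  have h := sum_sq_pos_of_ne_zero hp
  refine contDiffAt_pi.2 fun i => ContDiffAt.div (by fun_prop) ?_ (Real.sqrt_pos.2 h).ne'
  exact ContDiffAt.sqrt (by fun_prop) h.ne'

theorem fderiv_unitVec_apply {m : ℕ} {p : Fin m → ℝ} (hp : p ≠ 0) (a : Fin m → ℝ) (i : Fin m) :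
    fderiv ℝ (unitVec m) p a i = (a i - unitVec m p i * ∑ k, unitVec m p k * a k) /
      Real.sqrt (∑ k, p k ^ 2) := by
  have h := sum_sq_pos_of_ne_zero hp
  have hr := Real.sqrt_pos.2 h
  have h1 : HasDerivAt (fun t : ℝ => p + t • a) a 0 := by
    simpa using ((hasDerivAt_id' (0 : ℝ)).smul_const a).const_add p
  have h2 : HasFDerivAt (unitVec m) (fderiv ℝ (unitVec m) p) (p + (0 : ℝ) • a) := by
    simpa using ((contDiffAt_unitVec hp).differentiableAt two_ne_zero).hasFDerivAt
  have h3 := hasDerivAt_pi.1 (h2.comp_hasDerivAt (0 : ℝ) h1) i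
  have h4 : ∀ k, HasDerivAt (fun t : ℝ => p k + t * a k) (a k) 0 := fun k => by
    simpa using hasDerivAt_pi.1 h1 k
  have h5 : HasDerivAt (fun t : ℝ => ∑ k, (p k + t * a k) ^ 2) (∑ k, 2 * p k * a k) 0 := by
    refine (HasDerivAt.fun_sum fun k _ => (h4 k).fun_pow 2).congr_deriv ?_
    simp
  have h6 := (h4 i).fun_div (h5.sqrt (by simpa using h.ne')) (by simpa using hr.ne')
  have h7 := h3.unique h6
  rw [h7]
  simp only [zero_mul, add_zero, unitVec]
  set r := Real.sqrt (∑ k, p k ^ 2) with hrdef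
  have h8 : ∑ k, 2 * p k * a k = 2 * ∑ k, p k * a k := by
    rw [Finset.mul_sum]; exact Finset.sum_congr rfl fun k _ => by ring
  have h9 : ∑ k, p k / r * a k = (∑ k, p k * a k) / r := by
    rw [Finset.sum_div]; exact Finset.sum_congr rfl fun k _ => by ring
  rw [h8, h9]
  field_simp

/-- The trace of `L ∘ M` in coordinates. -/
def coordTrace {m : ℕ} (L M : (Fin m → ℝ) →L[ℝ] (Fin m → ℝ)) : ℝ :=
  ∑ i : Fin m, L (M (ee m i)) i

theorem abs_coordTrace_le {m : ℕ} (L M : (Fin m → ℝ) →L[ℝ] (Fin m → ℝ)) :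
    |coordTrace L M| ≤ m * (‖L‖ * ‖M‖) := by
  refine (Finset.abs_sum_le_sum_abs _ _).trans ?_
  have : ∀ i ∈ (Finset.univ : Finset (Fin m)), |L (M (ee m i)) i| ≤ ‖L‖ * ‖M‖ := fun i _ => by
    rw [← Real.norm_eq_abs]
    refine (norm_le_pi_norm _ i).trans ((L.le_opNorm _).trans ?_)
    gcongr
    exact (M.le_opNorm _).trans (mul_le_of_le_one_right (norm_nonneg _) (norm_ee_le i))
  refine (Finset.sum_le_card_nsmul _ _ _ this).trans ?_
  simp

theorem contDiffOn_gradF {m : ℕ} {U : Set (Fin m → ℝ)} (hU : IsOpen U)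
    {F : (Fin m → ℝ) → (Fin m → ℝ)} (hF : ContDiffOn ℝ 1 F U) {u : (Fin m → ℝ) → ℝ}
    (hu : ContDiffOn ℝ 2 u U) : ContDiffOn ℝ 1 (gradF m F u) U := by
  refine contDiffOn_pi.2 fun i => ContDiffOn.add ?_ (contDiffOn_pi.1 hF i)
  exact (hu.fderiv_of_isOpen hU (by norm_num)).clm_apply contDiffOn_const

theorem Hmc_eq_coordTrace {m : ℕ} {F : (Fin m → ℝ) → (Fin m → ℝ)} {u : (Fin m → ℝ) → ℝ}
    {x : Fin m → ℝ} (hG : DifferentiableAt ℝ (gradF m F u) x) (hne : gradF m F u x ≠ 0) :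
    Hmc m F u x =
      coordTrace (fderiv ℝ (unitVec m) (gradF m F u x)) (fderiv ℝ (gradF m F u) x) := by
  refine Finset.sum_congr rfl fun i _ => ?_
  have h := ((contDiffAt_unitVec hne).differentiableAt two_ne_zero).hasFDerivAt.comp x
    hG.hasFDerivAt
  have hi : HasFDerivAt (fun y => legN m F u y i) _ x := hasFDerivAt_pi'.1 h i
  rw [pd, hi.fderiv]
  rfl

theorem sum_frame_mul_frame {m : ℕ} (hm : 1 ≤ m) {n : Fin (m - 1) → Fin m → ℝ} {ν : Fin m → ℝ}
    (hn : ∀ α β, ∑ i, n α i * n β i = if α = β then 1 else 0)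
    (hnν : ∀ α, ∑ i, n α i * ν i = 0) (hν : ∑ i, ν i * ν i = 1) (i j : Fin m) :
    ∑ α, n α i * n α j = (if i = j then 1 else 0) - ν i * ν j := by
  let M : Matrix (Fin (m - 1) ⊕ Unit) (Fin m) ℝ := Matrix.of (Sum.elim n fun _ => ν)
  have hM : M * M.transpose = 1 := by
    ext a b
    rcases a with a | a <;> rcases b with b | b
    · simp [M, Matrix.mul_apply, hn, Matrix.one_apply]
    · simp [M, Matrix.mul_apply, hnν]
    · simp [M, Matrix.mul_apply, mul_comm (ν _), hnν]
    · simp [M, Matrix.mul_apply, hν]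
  have e : (Fin (m - 1) ⊕ Unit) ≃ Fin m := Fintype.equivOfCardEq (by simp; omega)
  have h := congrFun (congrFun ((Matrix.mul_eq_one_comm_of_equiv e).1 hM) i) j
  simp only [Matrix.mul_apply, Matrix.transpose_apply, Fintype.sum_sum_type, M, Matrix.of_apply,
    Sum.elim_inl, Sum.elim_inr, Finset.univ_unique, Finset.sum_singleton, Matrix.one_apply] at h
  linarith

theorem bilin_apply_eq_sum {m : ℕ} (B : (Fin m → ℝ) →L[ℝ] (Fin m → ℝ) →L[ℝ] ℝ)
    (a : Fin m → ℝ) : B a a = ∑ i, ∑ j, a i * a j * B (ee m i) (ee m j) := by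
  conv_lhs => rw [← sum_smul_ee a]
  simp only [map_sum, map_smul, _root_.sum_apply, _root_.smul_apply,
    smul_eq_mul, Finset.mul_sum]
  rw [Finset.sum_comm]
  exact Finset.sum_congr rfl fun i _ => Finset.sum_congr rfl fun j _ => by ring

theorem coordTrace_fderiv_unitVec {m : ℕ} (hm : 1 ≤ m) {p : Fin m → ℝ} (hp : p ≠ 0)
    {n : Fin (m - 1) → Fin m → ℝ}
    (hn : ∀ α β, ∑ i, n α i * n β i = if α = β then 1 else 0)
    (hnp : ∀ α, ∑ i, n α i * unitVec m p i = 0)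
    {M : (Fin m → ℝ) →L[ℝ] (Fin m → ℝ)} {B : (Fin m → ℝ) →L[ℝ] (Fin m → ℝ) →L[ℝ] ℝ}
    (hM : ∀ i j, M (ee m i) j = B (ee m i) (ee m j)) :
    Real.sqrt (∑ k, p k ^ 2) * coordTrace (fderiv ℝ (unitVec m) p) M = ∑ α, B (n α) (n α) := by
  have h := sum_sq_pos_of_ne_zero hp
  have hr := Real.sqrt_pos.2 h
  have hunit : ∑ i, unitVec m p i * unitVec m p i = 1 := by
    have h1 : ∀ i, unitVec m p i * unitVec m p i = p i ^ 2 / ∑ k, p k ^ 2 := fun i => by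
      rw [unitVec, div_mul_div_comm, Real.mul_self_sqrt h.le, sq]
    simp_rw [h1]
    rw [← Finset.sum_div, div_self h.ne']
  have hfr := sum_frame_mul_frame hm hn hnp hunit
  simp_rw [bilin_apply_eq_sum B]
  rw [Finset.sum_comm, coordTrace, Finset.mul_sum]
  refine Finset.sum_congr rfl fun i _ => ?_
  rw [Finset.sum_comm]
  simp_rw [← Finset.sum_mul, hfr, fderiv_unitVec_apply hp, hM]
  rw [mul_div_cancel₀ _ hr.ne']
  simp only [sub_mul, Finset.sum_sub_distrib, ite_mul, one_mul, zero_mul, Finset.sum_ite_eq,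
    Finset.mem_univ, if_true, Finset.mul_sum, mul_assoc]

theorem gradF_sub_gradF {m : ℕ} {F : (Fin m → ℝ) → (Fin m → ℝ)} {u v : (Fin m → ℝ) → ℝ}
    {x : Fin m → ℝ} (hu : DifferentiableAt ℝ u x) (hv : DifferentiableAt ℝ v x) (i : Fin m) :
    (gradF m F v x - gradF m F u x) i = fderiv ℝ (fun y => v y - u y) x (ee m i) := by
  rw [fderiv_fun_sub hv hu]
  simp [gradF, pd]

theorem exists_frame_hessian_le {m : ℕ} (hm : 1 ≤ m) {U : Set (Fin m → ℝ)} (hU : IsOpen U)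
    {F : (Fin m → ℝ) → (Fin m → ℝ)} (hF : ContDiffOn ℝ 1 F U) {u v : (Fin m → ℝ) → ℝ}
    (hu : ContDiffOn ℝ 2 u U) (hv : ContDiffOn ℝ 2 v U)
    (hns_u : ∀ x ∈ U, gradF m F u x ≠ 0) (hns_v : ∀ x ∈ U, gradF m F v x ≠ 0)
    (hH : ∀ x ∈ U, Hmc m F v x ≤ Hmc m F u x)
    {n : Fin (m - 1) → (Fin m → ℝ) → (Fin m → ℝ)}
    (hn : ∀ x ∈ U, ∀ α β, (∑ i, n α x i * n β x i) = if α = β then 1 else 0)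
    (hnu : ∀ x ∈ U, ∀ α, (∑ i, n α x i * legN m F u x i) = 0)
    {z : Fin m → ℝ} (hz : z ∈ U) (hzuv : gradF m F v z = gradF m F u z) :
    ∃ C : ℝ, ∀ᶠ x in nhds z,
      ∑ α, fderiv ℝ (fderiv ℝ fun y => v y - u y) x (n α x) (n α x) ≤
        C * ‖fderiv ℝ (fun y => v y - u y) x‖ := by
  have hUz := hU.mem_nhds hz
  have hGu := contDiffOn_gradF hU hF hu
  have hGv := contDiffOn_gradF hU hF hv
  have hcu := (hGu.contDiffAt hUz).continuousAt
  have hcv := (hGv.contDiffAt hUz).continuousAt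
  obtain ⟨K, S, hS, hKS⟩ := ((contDiffAt_unitVec (hns_u z hz)).fderiv_right (m := 1)
    (by norm_num)).exists_lipschitzOnWith
  have hDv : ContinuousAt (fderiv ℝ (gradF m F v)) z :=
    ((hGv.contDiffAt hUz).fderiv_right (m := 0) (by norm_num)).continuousAt
  have hr : ContinuousAt (fun x => Real.sqrt (∑ k, gradF m F u x k ^ 2)) z := by
    have : Continuous fun p : Fin m → ℝ => Real.sqrt (∑ k, p k ^ 2) := by fun_prop
    exact this.continuousAt.comp hcu
  set r₀ := Real.sqrt (∑ k, gradF m F u z k ^ 2)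
  refine ⟨(r₀ + 1) * (m * (K * (‖fderiv ℝ (gradF m F v) z‖ + 1))), ?_⟩
  filter_upwards [hUz, hcu hS, hcv (hzuv ▸ hS), hDv.norm.eventually (gt_mem_nhds (lt_add_one _)),
    hr.eventually (gt_mem_nhds (lt_add_one _))] with x hx hxu hxv hxD hxr
  have hUx := hU.mem_nhds hx
  have hdu : ∀ y ∈ U, DifferentiableAt ℝ u y := fun y hy =>
    (hu.contDiffAt (hU.mem_nhds hy)).differentiableAt two_ne_zero
  have hdv : ∀ y ∈ U, DifferentiableAt ℝ v y := fun y hy =>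
    (hv.contDiffAt (hU.mem_nhds hy)).differentiableAt two_ne_zero
  have hdGu := (hGu.contDiffAt hUx).differentiableAt one_ne_zero
  have hdGv := (hGv.contDiffAt hUx).differentiableAt one_ne_zero
  set w : (Fin m → ℝ) → ℝ := fun y => v y - u y with hw
  set A := fderiv ℝ (unitVec m) (gradF m F u x)
  set A' := fderiv ℝ (unitVec m) (gradF m F v x)
  set M := fderiv ℝ (gradF m F u) x
  set M' := fderiv ℝ (gradF m F v) x
  have hHx := hH x hx
  rw [Hmc_eq_coordTrace hdGu (hns_u x hx), Hmc_eq_coordTrace hdGv (hns_v x hx)] at hHx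
  have hsplit : coordTrace A' M' - coordTrace A M =
      coordTrace A (M' - M) + coordTrace (A' - A) M' := by
    simp only [coordTrace, ← Finset.sum_add_distrib, ← Finset.sum_sub_distrib]
    refine Finset.sum_congr rfl fun i _ => ?_
    simp
  have hdw : DifferentiableAt ℝ (fderiv ℝ w) x :=
    (((hv.sub hu).contDiffAt hUx : ContDiffAt ℝ 2 w x).fderiv_right (m := 1)
      (by norm_num)).differentiableAt one_ne_zero
  have hMM : ∀ i j, (M' - M) (ee m i) j = fderiv ℝ (fderiv ℝ w) x (ee m i) (ee m j) := by
    intro i j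
    have h1 : HasFDerivAt (fun y => (gradF m F v y - gradF m F u y) j)
        ((ContinuousLinearMap.proj j).comp (M' - M)) x :=
      hasFDerivAt_pi'.1 (hdGv.hasFDerivAt.sub hdGu.hasFDerivAt) j
    have h2 : HasFDerivAt (fun y => fderiv ℝ w y (ee m j))
        ((ContinuousLinearMap.apply ℝ ℝ (ee m j)).comp (fderiv ℝ (fderiv ℝ w) x)) x :=
      (ContinuousLinearMap.apply ℝ ℝ (ee m j)).hasFDerivAt.comp x hdw.hasFDerivAt
    have h3 : (fun y => (gradF m F v y - gradF m F u y) j) =ᶠ[nhds x]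
        fun y => fderiv ℝ w y (ee m j) := by
      filter_upwards [hUx] with y hy
      exact gradF_sub_gradF (hdu y hy) (hdv y hy) j
    have h4 := (h2.congr_of_eventuallyEq h3).unique h1
    exact (congrArg (fun L : (Fin m → ℝ) →L[ℝ] ℝ => L (ee m i)) h4).symm
  rw [← coordTrace_fderiv_unitVec hm (hns_u x hx) (hn x hx) (hnu x hx) hMM]
  have hAA : ‖A' - A‖ ≤ K * ‖fderiv ℝ w x‖ := by
    refine (hKS.norm_sub_le hxv hxu).trans ?_
    gcongr
    refine (pi_norm_le_iff_of_nonneg (norm_nonneg _)).2 fun i => ?_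
    rw [gradF_sub_gradF (hdu x hx) (hdv x hx)]
    exact (ContinuousLinearMap.le_opNorm _ _).trans
      (mul_le_of_le_one_right (norm_nonneg _) (norm_ee_le i))
  have hT : coordTrace A (M' - M) ≤
      m * (K * (‖fderiv ℝ (gradF m F v) z‖ + 1)) * ‖fderiv ℝ w x‖ := by
    have h1 := neg_abs_le (coordTrace (A' - A) M')
    have h2 := abs_coordTrace_le (A' - A) M'
    have h3 : ‖A' - A‖ * ‖M'‖ ≤ K * ‖fderiv ℝ w x‖ * (‖fderiv ℝ (gradF m F v) z‖ + 1) :=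
      mul_le_mul hAA hxD.le (norm_nonneg _) (by positivity)
    have h4 := mul_le_mul_of_nonneg_left h3 (Nat.cast_nonneg m : (0 : ℝ) ≤ m)
    linarith
  calc _ ≤ Real.sqrt (∑ k, gradF m F u x k ^ 2) *
        (m * (K * (‖fderiv ℝ (gradF m F v) z‖ + 1)) * ‖fderiv ℝ w x‖) := by gcongr
    _ ≤ (r₀ + 1) * (m * (K * (‖fderiv ℝ (gradF m F v) z‖ + 1)) * ‖fderiv ℝ w x‖) := by gcongr
    _ = _ := by ring

theorem norm_sq_le_sum_sq {m : ℕ} (x : Fin m → ℝ) : ‖x‖ ^ 2 ≤ ∑ i, x i ^ 2 := by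
  have h : ‖x‖ ≤ Real.sqrt (∑ i, x i ^ 2) :=
    (pi_norm_le_iff_of_nonneg (Real.sqrt_nonneg _)).2 fun i => Real.abs_le_sqrt
      (Finset.single_le_sum (f := fun i => x i ^ 2) (fun j _ => sq_nonneg _) (Finset.mem_univ i))
  calc ‖x‖ ^ 2 ≤ Real.sqrt (∑ i, x i ^ 2) ^ 2 := by gcongr
    _ = _ := Real.sq_sqrt (Finset.sum_nonneg fun i _ => sq_nonneg _)

theorem LieSpan.contDiffOn_and_proxTangent {m : ℕ} {U Z : Set (Fin m → ℝ)} (hU : IsOpen U)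
    (hZU : Z ⊆ U) (hZ : closure Z ∩ U ⊆ Z) {S : Set ((Fin m → ℝ) → (Fin m → ℝ))}
    (hS : ∀ X ∈ S, ContDiffOn ℝ (⊤ : ℕ∞) X U ∧ ProxTangent Z X)
    {X : (Fin m → ℝ) → (Fin m → ℝ)} (hX : LieSpan U S X) :
    ContDiffOn ℝ (⊤ : ℕ∞) X U ∧ ProxTangent Z X := by
  induction hX with
  | base X hX => exact hS X hX
  | smul f X hf _ ih =>
    refine ⟨hf.smul ih.1, fun z hz ℓ hℓ => ?_⟩
    rw [map_smul, ih.2 z hz ℓ hℓ, smul_zero]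
  | add X Y _ _ ihX ihY =>
    refine ⟨ihX.1.add ihY.1, fun z hz ℓ hℓ => ?_⟩
    rw [map_add, ihX.2 z hz ℓ hℓ, ihY.2 z hz ℓ hℓ, add_zero]
  | bracket X Y _ _ ihX ihY =>
    have hd : ∀ f : (Fin m → ℝ) → (Fin m → ℝ), ContDiffOn ℝ (⊤ : ℕ∞) f U →
        ContDiffOn ℝ (⊤ : ℕ∞) (fderiv ℝ f) U := fun f hf => hf.fderiv_of_isOpen hU (by simp)
    have h1 : (1 : WithTop ℕ∞) ≤ ((⊤ : ℕ∞) : WithTop ℕ∞) := by exact_mod_cast le_top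
    exact ⟨((hd Y ihY.1).clm_apply ihX.1).sub ((hd X ihX.1).clm_apply ihY.1),
      ProxTangent.bracket (EuclideanSpace.equiv (Fin m) ℝ).symm hU hZU hZ (ihX.1.of_le h1)
        (ihY.1.of_le h1) ihX.2 ihY.2⟩

/-- Theorem F: strong maximum principle for the horizontal
(p-)mean curvature operator `H_F` at nonsingular points. -/
theorem strong_max_principle_horizontal_mean_curvature
    (m : ℕ) (hm : 3 ≤ m)
    (U : Set (Fin m → ℝ)) (hUopen : IsOpen U) (hUconn : IsConnected U)
    (F : (Fin m → ℝ) → (Fin m → ℝ)) (hF : ContDiffOn ℝ 1 F U)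
    (u v : (Fin m → ℝ) → ℝ)
    (hu : ContDiffOn ℝ 2 u U) (hv : ContDiffOn ℝ 2 v U)
    (hns_u : ∀ x ∈ U, gradF m F u x ≠ 0)
    (hns_v : ∀ x ∈ U, gradF m F v x ≠ 0)
    (hH : ∀ x ∈ U, Hmc m F v x ≤ Hmc m F u x)
    (hvu : ∀ x ∈ U, u x ≤ v x)
    (p₀ : Fin m → ℝ) (hp₀ : p₀ ∈ U) (htouch : v p₀ = u p₀)
    (hframe_u : GoodFrame m U F u) (hframe_v : GoodFrame m U F v) :
    ∀ x ∈ U, v x = u x := by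
  set Z : Set (Fin m → ℝ) := {x | x ∈ U ∧ v x = u x} with hZdef
  have hZU : Z ⊆ U := fun x hx => hx.1
  have hZ : closure Z ∩ U ⊆ Z := by
    rintro x ⟨hx, hxU⟩
    have hcw : ContinuousAt (fun y => v y - u y) x :=
      (hv.contDiffAt (hUopen.mem_nhds hxU)).continuousAt.sub
        (hu.contDiffAt (hUopen.mem_nhds hxU)).continuousAt
    have h0 := hcw.continuousWithinAt.mem_closure_image hx
    have himg : (fun y => v y - u y) '' Z ⊆ {0} := by
      rintro _ ⟨y, hy, rfl⟩
      exact sub_eq_zero.2 hy.2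
    have h1 := closure_mono himg h0
    rw [closure_singleton] at h1
    exact ⟨hxU, sub_eq_zero.1 h1⟩
  obtain ⟨n, hn, hnn, hnu, hspan⟩ := hframe_u
  have htan : ∀ X ∈ Set.range n, ContDiffOn ℝ (⊤ : ℕ∞) X U ∧ ProxTangent Z X := by
    rintro _ ⟨α, rfl⟩
    refine ⟨hn α, fun z hz ℓ hℓ => ?_⟩
    have hUz := hUopen.mem_nhds hz.1
    have huz := hu.contDiffAt hUz
    have hvz := hv.contDiffAt hUz
    have hwn : ∀ᶠ y in nhds z, 0 ≤ v y - u y := by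
      filter_upwards [hUz] with y hy using sub_nonneg.2 (hvu y hy)
    have hwz : v z - u z = 0 := sub_eq_zero.2 hz.2
    have hmin : IsLocalMin (fun y => v y - u y) z := by
      filter_upwards [hwn] with y hy
      rwa [hwz]
    have hgrad : gradF m F v z = gradF m F u z := by
      rw [← sub_eq_zero]
      funext i
      rw [gradF_sub_gradF (huz.differentiableAt two_ne_zero) (hvz.differentiableAt two_ne_zero),
        hmin.fderiv_eq_zero]
      rfl
    obtain ⟨C, hC⟩ := exists_frame_hessian_le (by omega) hUopen hF hu hv hns_u hns_v hH hnn hnu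
      hz.1 hgrad
    refine hℓ.apply_eq_zero_of_supersolution (q := fun x => ∑ i, x i ^ 2) (by fun_prop) (by simp)
      norm_sq_le_sum_sq (hvz.sub huz) hwn hwz ?_
      (fun β => ((hn β).contDiffAt hUz).continuousAt) hC α
    filter_upwards [hUz] with y hy hy0 using ⟨hy, sub_eq_zero.1 hy0⟩
  by_contra hcon
  obtain ⟨z, hz, ℓ, hℓ, hℓ0⟩ := exists_proxNormal_ne_zero_of_equiv
    (EuclideanSpace.equiv (Fin m) ℝ).symm hUopen hUconn.isPreconnected hZU hZ ⟨p₀, hp₀, htouch⟩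
    (fun h => hcon fun x hx => (h hx).2)
  have hker : Submodule.span ℝ {a | ∃ X, LieSpan U (Set.range n) X ∧ X z = a} ≤
      LinearMap.ker (ℓ : (Fin m → ℝ) →ₗ[ℝ] ℝ) := by
    refine Submodule.span_le.2 ?_
    rintro _ ⟨X, hX, rfl⟩
    exact (hX.contDiffOn_and_proxTangent hUopen hZU hZ htan).2 z hz ℓ hℓ
  rw [hspan z hz.1, top_le_iff] at hker
  refine hℓ0 (ContinuousLinearMap.ext fun x => ?_)
  have hx : x ∈ LinearMap.ker (ℓ : (Fin m → ℝ) →ₗ[ℝ] ℝ) := hker ▸ Submodule.mem_top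
  exact hx
end
end
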